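/- arXiv:2112.08568 — 2 statements merged into one kernel-verified Lean document; each statement's English description precedes it below -/
import Mathlib

section
/- Bound for the GL(3) Whittaker function: Fix α = (α₁, α₂, α₃) ∈ ℂ³ with Re α₁ = Re α₂ = Re α₃ = 0 and α₁ + α₂ + α₃ = 0. For any real numbers A₀ < 1 and A₁ < 1 there exists a constant C > 0 (depending only on α, A₀, A₁) such that |W_{−α}(y₀, y₁)| ≤ C · y₀^{A₀} · y₁^{A₁} for all y₀, y₁ > 0. -/
open Complex MeasureTheory Set

/-- `Γ_ℝ(s) := π^{−s/2} Γ(s/2)`. -/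
noncomputable def GammaR (s : ℂ) : ℂ := (Real.pi : ℂ) ^ (-s / 2) * Complex.Gamma (s / 2)

/-- The Mellin kernel `G_α(s₀,s₁)` of the GL(3) Whittaker function. -/
noncomputable def Gfun (α : Fin 3 → ℂ) (s0 s1 : ℂ) : ℂ :=
  (∏ i, GammaR (s0 + α i) * GammaR (s1 - α i)) / GammaR (s0 + s1)

/-- The GL(3) Whittaker function, defined by its Mellin–Barnes integral on the lines
`Re s₀ = Re s₁ = 1`. -/
noncomputable def W3 (α : Fin 3 → ℂ) (y0 y1 : ℝ) : ℂ :=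
  (1 / 4) * (1 / (2 * (Real.pi : ℂ))) ^ 2 *
    ∫ t0 : ℝ, ∫ t1 : ℝ,
      Gfun α (1 + t0 * I) (1 + t1 * I) *
        (y0 : ℂ) ^ (-(t0 * I)) * (y1 : ℂ) ^ (-(t1 * I))

/-- A Gamma integral is dominated by its value at the real part. -/
lemma norm_Gamma_le_norm_Gamma_re {s : ℂ} (hs : 0 < s.re) :
    ‖Complex.Gamma s‖ ≤ ‖Complex.Gamma (s.re : ℂ)‖ := by
  rw [Complex.Gamma_ofReal, Complex.norm_real, Real.Gamma_eq_integral hs,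
    Complex.Gamma_eq_integral hs, Complex.GammaIntegral]
  refine (norm_integral_le_integral_norm _).trans (le_trans (le_of_eq ?_) (le_abs_self _))
  refine setIntegral_congr_fun measurableSet_Ioi fun x hx => ?_
  have hx' : 0 < x := hx
  simp only [norm_mul, Complex.norm_real, norm_cpow_eq_rpow_re_of_pos hx', sub_re, one_re,
    Real.norm_eq_abs, Real.abs_exp]

/-- The Beta integral is dominated by its value at the real parts. -/
lemma norm_betaIntegral_le {u v : ℂ} :
    ‖betaIntegral u v‖ ≤ ‖betaIntegral (u.re : ℂ) (v.re : ℂ)‖ := by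
  have key : betaIntegral (u.re : ℂ) (v.re : ℂ) =
      ((∫ x in (0 : ℝ)..1, ‖(x : ℂ) ^ (u - 1) * (1 - (x : ℂ)) ^ (v - 1)‖ : ℝ) : ℂ) := by
    rw [betaIntegral, ← intervalIntegral.integral_ofReal,
      intervalIntegral.integral_of_le zero_le_one, intervalIntegral.integral_of_le zero_le_one,
      integral_Ioc_eq_integral_Ioo, integral_Ioc_eq_integral_Ioo]
    refine setIntegral_congr_fun measurableSet_Ioo fun x hx => ?_
    have h1 : 0 < 1 - x := sub_pos.mpr hx.2
    have h2 : (1 - (x : ℂ)) = ((1 - x : ℝ) : ℂ) := by push_cast; rfl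
    simp only [h2, norm_mul, norm_cpow_eq_rpow_re_of_pos hx.1, norm_cpow_eq_rpow_re_of_pos h1,
      ofReal_mul, ofReal_cpow hx.1.le, ofReal_cpow h1.le, sub_re, one_re]
    push_cast
    rfl
  rw [key, Complex.norm_real]
  exact (intervalIntegral.norm_integral_le_integral_norm zero_le_one).trans (le_abs_self _)

lemma norm_GammaR (s : ℂ) :
    ‖GammaR s‖ = Real.pi ^ (-s.re / 2) * ‖Complex.Gamma (s / 2)‖ := by
  rw [GammaR, norm_mul, norm_cpow_eq_rpow_re_of_pos Real.pi_pos]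
  simp

lemma norm_GammaR_le_norm_GammaR_re {s : ℂ} (hs : 0 < s.re) :
    ‖GammaR s‖ ≤ ‖GammaR (s.re : ℂ)‖ := by
  rw [norm_GammaR, norm_GammaR, ofReal_re]
  have h := norm_Gamma_le_norm_Gamma_re (s := s / 2) (by simpa using hs)
  have e : (((s / 2).re : ℝ) : ℂ) = (s.re : ℂ) / 2 := by simp
  rw [e] at h
  gcongr

lemma norm_GammaR_beta_le {u v : ℂ} (hu : 0 < u.re) (hv : 0 < v.re) :
    ‖GammaR u * GammaR v / GammaR (u + v)‖ ≤
      ‖GammaR u.re * GammaR v.re / GammaR (u.re + v.re)‖ := by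
  have key : ∀ {a b : ℂ}, 0 < a.re → 0 < b.re →
      GammaR a * GammaR b / GammaR (a + b) = betaIntegral (a / 2) (b / 2) := by
    intro a b ha hb
    have hne : GammaR (a + b) ≠ 0 :=
      Gammaℝ_ne_zero_of_re_pos (s := a + b) (by rw [add_re]; positivity)
    have hpi : (Real.pi : ℂ) ≠ 0 := by exact_mod_cast Real.pi_ne_zero
    rw [div_eq_iff hne]
    have h := Gamma_mul_Gamma_eq_betaIntegral (s := a / 2) (t := b / 2) (by simpa) (by simpa)
    have hp : (Real.pi : ℂ) ^ (-(a + b) / 2) = Real.pi ^ (-a / 2) * Real.pi ^ (-b / 2) := by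
      rw [← cpow_add _ _ hpi]; congr 1; ring
    simp only [GammaR, hp, add_div]
    linear_combination (Real.pi : ℂ) ^ (-a / 2) * Real.pi ^ (-b / 2) * h
  rw [key hu hv, key (by simpa) (by simpa)]
  simpa using norm_betaIntegral_le (u := u / 2) (v := v / 2)

lemma differentiableAt_GammaR {s : ℂ} (hs : 0 < s.re) : DifferentiableAt ℂ GammaR s := by
  have h : GammaR = fun z => ((Gammaℝ z)⁻¹)⁻¹ := by
    funext z; rw [inv_inv]; rfl
  rw [h]
  exact (differentiable_Gammaℝ_inv s).inv (inv_ne_zero (Gammaℝ_ne_zero_of_re_pos hs))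

lemma GammaR_ne_zero {s : ℂ} (hs : 0 < s.re) : GammaR s ≠ 0 := Gammaℝ_ne_zero_of_re_pos hs

/-- Decay of `Γ_ℝ` by one power in vertical strips of the right half-plane. -/
lemma exists_norm_GammaR_le {m M : ℝ} (hm : 0 < m) {a : ℂ} (ha : a.re = 0) :
    ∃ C : ℝ, 0 < C ∧ ∀ s : ℂ, s.re ∈ Icc m M →
      ‖GammaR (s + a)‖ ≤ C / √(1 + s.im ^ 2) := by
  have hc : ContinuousOn (fun x : ℝ => GammaR ((x : ℂ) + 2)) (Icc m M) := by
    intro x hx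
    have hx' : 0 < x := hm.trans_le hx.1
    have h1 : ContinuousAt GammaR ((x : ℂ) + 2) :=
      (differentiableAt_GammaR (by simp; positivity)).continuousAt
    exact (ContinuousAt.comp (f := fun x : ℝ => (x : ℂ) + 2) h1
      (by fun_prop)).continuousWithinAt
  obtain ⟨B, hB⟩ := isCompact_Icc.exists_bound_of_continuousOn hc
  set K : ℝ := 2 + (1 + 2 * a.im ^ 2) / m ^ 2 with hK
  have hKpos : 0 < K := by positivity
  refine ⟨(|B| + 1) * 2 * Real.pi * √K, by positivity, fun s hs => ?_⟩
  have hre : (s + a).re = s.re := by simp [ha]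
  have hpos : 0 < (s + a).re := by rw [hre]; exact hm.trans_le hs.1
  have hne : s + a ≠ 0 := by rintro h; simp [h] at hpos
  have hrec : GammaR (s + a + 2) = GammaR (s + a) * (s + a) / 2 / Real.pi := Gammaℝ_add_two hne
  have hpi : (Real.pi : ℂ) ≠ 0 := by exact_mod_cast Real.pi_ne_zero
  have hG : GammaR (s + a) = GammaR (s + a + 2) * 2 * Real.pi / (s + a) := by
    rw [hrec]; field_simp
  have hbd : ‖GammaR (s + a + 2)‖ ≤ |B| + 1 := by
    have h1 := norm_GammaR_le_norm_GammaR_re (s := s + a + 2)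
      (by rw [add_re]; simp only [re_ofNat]; positivity)
    have h2 : (((s + a + 2).re : ℝ) : ℂ) = (s.re : ℂ) + 2 := by
      rw [add_re, hre]; simp
    rw [h2] at h1
    have h3 := hB s.re hs
    linarith [le_abs_self B]
  have hlow : √(1 + s.im ^ 2) ≤ √K * ‖s + a‖ := by
    rw [← Real.sqrt_sq (norm_nonneg (s + a)), ← Real.sqrt_mul hKpos.le]
    apply Real.sqrt_le_sqrt
    rw [Complex.sq_norm, normSq_apply, hre, add_im]
    have h1 : 1 + 2 * a.im ^ 2 ≤ (1 + 2 * a.im ^ 2) / m ^ 2 * s.re ^ 2 := by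
      rw [div_mul_eq_mul_div, le_div_iff₀ (by positivity)]
      have : m ^ 2 ≤ s.re ^ 2 := by gcongr; exact hs.1
      gcongr
    have h2 : 0 ≤ (1 + 2 * a.im ^ 2) / m ^ 2 * (s.im + a.im) ^ 2 := by positivity
    rw [hK]
    nlinarith [sq_nonneg (s.im + 2 * a.im), sq_nonneg s.re]
  have hn : 0 < ‖s + a‖ := norm_pos_iff.mpr hne
  rw [hG, norm_div, norm_mul, norm_mul, Complex.norm_real, Real.norm_of_nonneg Real.pi_pos.le,
    Complex.norm_two, div_le_div_iff₀ hn (by positivity)]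
  calc ‖GammaR (s + a + 2)‖ * 2 * Real.pi * √(1 + s.im ^ 2)
      ≤ (|B| + 1) * 2 * Real.pi * (√K * ‖s + a‖) := by gcongr
    _ = _ := by ring

/-- Uniform quadratic decay of the Mellin kernel on vertical strips of the right half-plane. -/
lemma exists_norm_Gfun_le {α : Fin 3 → ℂ} (hre : ∀ i, (α i).re = 0) {m M : ℝ} (hm : 0 < m) :
    ∃ C : ℝ, 0 < C ∧ ∀ s0 s1 : ℂ, s0.re ∈ Icc m M → s1.re ∈ Icc m M →
      ‖Gfun α s0 s1‖ ≤ C * ((1 + s0.im ^ 2)⁻¹ * (1 + s1.im ^ 2)⁻¹) := by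
  have hc : ContinuousOn (fun p : ℝ × ℝ => GammaR p.1 * GammaR p.2 / GammaR (p.1 + p.2))
      (Icc m M ×ˢ Icc m M) := by
    rintro ⟨x, y⟩ ⟨hx, hy⟩
    have hx' : 0 < x := hm.trans_le hx.1
    have hy' : 0 < y := hm.trans_le hy.1
    have h1 : ContinuousAt GammaR ((x, y).1 : ℂ) :=
      (differentiableAt_GammaR (by simpa)).continuousAt
    have h2 : ContinuousAt GammaR ((x, y).2 : ℂ) :=
      (differentiableAt_GammaR (by simpa)).continuousAt
    have h3p : 0 < (((x, y).1 : ℂ) + ((x, y).2 : ℂ)).re := by simp; positivity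
    have h3 := (differentiableAt_GammaR h3p).continuousAt
    refine ContinuousAt.continuousWithinAt (ContinuousAt.div (ContinuousAt.mul ?_ ?_) ?_
      (GammaR_ne_zero h3p))
    · exact ContinuousAt.comp (f := fun p : ℝ × ℝ => (p.1 : ℂ)) h1 (by fun_prop)
    · exact ContinuousAt.comp (f := fun p : ℝ × ℝ => (p.2 : ℂ)) h2 (by fun_prop)
    · exact ContinuousAt.comp (f := fun p : ℝ × ℝ => (p.1 : ℂ) + (p.2 : ℂ)) h3 (by fun_prop)
  obtain ⟨B, hB⟩ := (isCompact_Icc.prod isCompact_Icc).exists_bound_of_continuousOn hc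
  obtain ⟨C1, hC1, h1⟩ := exists_norm_GammaR_le (M := M) hm (hre 1)
  obtain ⟨C2, hC2, h2⟩ := exists_norm_GammaR_le (M := M) hm (hre 2)
  obtain ⟨D1, hD1, g1⟩ := exists_norm_GammaR_le (a := -α 1) (M := M) hm (by simp [hre])
  obtain ⟨D2, hD2, g2⟩ := exists_norm_GammaR_le (a := -α 2) (M := M) hm (by simp [hre])
  refine ⟨(|B| + 1) * C1 * C2 * D1 * D2, by positivity, fun s0 s1 hs0 hs1 => ?_⟩
  have hsplit : Gfun α s0 s1 =
      (GammaR (s0 + α 0) * GammaR (s1 - α 0) / GammaR ((s0 + α 0) + (s1 - α 0))) *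
        (GammaR (s0 + α 1) * GammaR (s0 + α 2)) *
        (GammaR (s1 + -α 1) * GammaR (s1 + -α 2)) := by
    rw [Gfun, Fin.prod_univ_three, show s0 + α 0 + (s1 - α 0) = s0 + s1 by ring]
    simp only [← sub_eq_add_neg]
    ring
  have hr0 : (s0 + α 0).re = s0.re := by simp [hre]
  have hr1 : (s1 - α 0).re = s1.re := by simp [hre]
  have hb := norm_GammaR_beta_le (u := s0 + α 0) (v := s1 - α 0)
    (by rw [hr0]; exact hm.trans_le hs0.1) (by rw [hr1]; exact hm.trans_le hs1.1)
  rw [hr0, hr1] at hb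
  have hb' := hb.trans ((hB (s0.re, s1.re) ⟨hs0, hs1⟩).trans
    (show B ≤ |B| + 1 by linarith [le_abs_self B]))
  have hq : ∀ t : ℝ, (1 + t ^ 2)⁻¹ = (√(1 + t ^ 2))⁻¹ * (√(1 + t ^ 2))⁻¹ := fun t => by
    rw [← mul_inv, Real.mul_self_sqrt (by positivity)]
  rw [hsplit, norm_mul, norm_mul, norm_mul (GammaR (s0 + α 1)), norm_mul (GammaR (s1 + -α 1))]
  calc _ ≤ (|B| + 1) * (C1 / √(1 + s0.im ^ 2) * (C2 / √(1 + s0.im ^ 2))) *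
        (D1 / √(1 + s1.im ^ 2) * (D2 / √(1 + s1.im ^ 2))) := by
        gcongr
        exacts [h1 s0 hs0, h2 s0 hs0, g1 s1 hs1, g2 s1 hs1]
    _ = _ := by rw [hq, hq]; ring

/-- Moving a vertical contour inside a strip of holomorphy with quadratic decay. -/
lemma integral_vertical_line_eq {f : ℂ → ℂ} {a b C : ℝ}
    (hf : ∀ s : ℂ, s.re ∈ uIcc a b → DifferentiableAt ℂ f s)
    (hb : ∀ s : ℂ, s.re ∈ uIcc a b → ‖f s‖ ≤ C * (1 + s.im ^ 2)⁻¹) :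
    ∫ t : ℝ, f (a + t * I) = ∫ t : ℝ, f (b + t * I) := by
  have hintegrable : ∀ c ∈ uIcc a b, Integrable fun t : ℝ => f (c + t * I) := by
    intro c hc
    have hcont : Continuous fun t : ℝ => f (c + t * I) := by
      refine continuous_iff_continuousAt.mpr fun t => ?_
      exact ContinuousAt.comp (f := fun t : ℝ => (c : ℂ) + t * I)
        (hf _ (by simpa using hc)).continuousAt (by fun_prop)
    refine (integrable_inv_one_add_sq.const_mul C).mono' hcont.aestronglyMeasurable
      (Filter.Eventually.of_forall fun t => ?_)
    simpa using hb (c + t * I) (by simpa using hc)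
  have hdecay : Filter.Tendsto (fun T : ℝ => C * (1 + T ^ 2)⁻¹ * |b - a|) Filter.atTop
      (nhds 0) := by
    have h : Filter.Tendsto (fun T : ℝ => 1 + T ^ 2) Filter.atTop Filter.atTop :=
      Filter.tendsto_atTop_add_const_left _ _ (Filter.tendsto_pow_atTop two_ne_zero)
    simpa using (h.inv_tendsto_atTop.const_mul C).mul_const |b - a|
  have hhor : ∀ T : ℝ, ‖∫ x in a..b, f (x + T * I)‖ ≤ C * (1 + T ^ 2)⁻¹ * |b - a| := by
    intro T
    refine intervalIntegral.norm_integral_le_of_norm_le_const fun x hx => ?_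
    simpa using hb (x + T * I) (by simpa using uIoc_subset_uIcc hx)
  have htop : Filter.Tendsto (fun T : ℝ => ∫ x in a..b, f (x + T * I)) Filter.atTop (nhds 0) :=
    squeeze_zero_norm hhor hdecay
  have hbot : Filter.Tendsto (fun T : ℝ => ∫ x in a..b, f (x + ((-T : ℝ) : ℂ) * I)) Filter.atTop
      (nhds 0) :=
    squeeze_zero_norm (fun T => by simpa only [neg_sq] using hhor (-T)) hdecay
  have hvert : ∀ c ∈ uIcc a b, Filter.Tendsto (fun T : ℝ => ∫ t in -T..T, f (c + t * I))
      Filter.atTop (nhds (∫ t : ℝ, f (c + t * I))) := fun c hc =>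
    intervalIntegral_tendsto_integral (hintegrable c hc) Filter.tendsto_neg_atTop_atBot Filter.tendsto_id
  have hrect : ∀ T : ℝ, (∫ x in a..b, f (x + ((-T : ℝ) : ℂ) * I)) -
      (∫ x in a..b, f (x + T * I)) + I • (∫ t in -T..T, f (b + t * I)) -
      I • (∫ t in -T..T, f (a + t * I)) = 0 := by
    intro T
    have h := integral_boundary_rect_eq_zero_of_differentiableOn f ⟨a, -T⟩ ⟨b, T⟩
      (fun s hs => (hf s hs.1).differentiableWithinAt)
    exact h
  have hlim := ((hbot.sub htop).add ((hvert b right_mem_uIcc).const_smul I)).sub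
    ((hvert a left_mem_uIcc).const_smul I)
  simp only [hrect] at hlim
  have h0 := tendsto_nhds_unique hlim tendsto_const_nhds
  have h1 : I * ((∫ t : ℝ, f (b + t * I)) - ∫ t : ℝ, f (a + t * I)) = 0 := by
    simpa [smul_eq_mul, mul_sub] using h0
  exact (sub_eq_zero.mp ((mul_eq_zero.mp h1).resolve_left I_ne_zero)).symm

lemma differentiableAt_Gfun {α : Fin 3 → ℂ} (hre : ∀ i, (α i).re = 0) {s0 s1 : ℂ}
    (h0 : 0 < s0.re) (h1 : 0 < s1.re) :
    DifferentiableAt ℂ (fun p : ℂ × ℂ => Gfun α p.1 p.2) (s0, s1) := by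
  have hcomp : ∀ g : ℂ × ℂ → ℂ, DifferentiableAt ℂ g (s0, s1) → 0 < (g (s0, s1)).re →
      DifferentiableAt ℂ (fun p => GammaR (g p)) (s0, s1) := fun g hg hpos =>
    (differentiableAt_GammaR hpos).comp (s0, s1) hg
  have hsum : 0 < (s0 + s1).re := by rw [add_re]; positivity
  simp only [Gfun, div_eq_mul_inv, Fin.prod_univ_three]
  refine DifferentiableAt.mul ?_ (DifferentiableAt.inv
    (hcomp (fun p => p.1 + p.2) (by fun_prop) hsum) (GammaR_ne_zero hsum))
  refine DifferentiableAt.mul (DifferentiableAt.mul ?_ ?_) ?_ <;>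
    exact (hcomp (fun p => p.1 + α _) (by fun_prop) (by simpa [hre])).mul
      (hcomp (fun p => p.2 - α _) (by fun_prop) (by simpa [hre]))

/-- The integrand of the Mellin–Barnes integral, with the monomial `y₀ y₁` absorbed. -/
noncomputable def whittakerIntegrand (α : Fin 3 → ℂ) (y0 y1 : ℝ) (s0 s1 : ℂ) : ℂ :=
  Gfun α s0 s1 * (y0 : ℂ) ^ (1 - s0) * (y1 : ℂ) ^ (1 - s1)

lemma differentiableAt_whittakerIntegrand {α : Fin 3 → ℂ} (hre : ∀ i, (α i).re = 0)
    {y0 y1 : ℝ} (hy0 : 0 < y0) (hy1 : 0 < y1) {s0 s1 : ℂ} (h0 : 0 < s0.re) (h1 : 0 < s1.re) :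
    DifferentiableAt ℂ (fun p : ℂ × ℂ => whittakerIntegrand α y0 y1 p.1 p.2) (s0, s1) := by
  have hy0' : (y0 : ℂ) ≠ 0 := ofReal_ne_zero.mpr hy0.ne'
  have hy1' : (y1 : ℂ) ≠ 0 := ofReal_ne_zero.mpr hy1.ne'
  refine ((differentiableAt_Gfun hre h0 h1).mul ?_).mul ?_
  · exact DifferentiableAt.const_cpow (by fun_prop) (Or.inl hy0')
  · exact DifferentiableAt.const_cpow (by fun_prop) (Or.inl hy1')

lemma norm_whittakerIntegrand (α : Fin 3 → ℂ) {y0 y1 : ℝ} (hy0 : 0 < y0) (hy1 : 0 < y1)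
    (s0 s1 : ℂ) : ‖whittakerIntegrand α y0 y1 s0 s1‖ =
      ‖Gfun α s0 s1‖ * y0 ^ (1 - s0.re) * y1 ^ (1 - s1.re) := by
  simp [whittakerIntegrand, norm_cpow_eq_rpow_re_of_pos hy0, norm_cpow_eq_rpow_re_of_pos hy1]

lemma exists_norm_whittakerIntegrand_le {α : Fin 3 → ℂ} (hre : ∀ i, (α i).re = 0)
    {y0 y1 : ℝ} (hy0 : 0 < y0) (hy1 : 0 < y1) {m M : ℝ} (hm : 0 < m) :
    ∃ C : ℝ, ∀ s0 s1 : ℂ, s0.re ∈ Icc m M → s1.re ∈ Icc m M →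
      ‖whittakerIntegrand α y0 y1 s0 s1‖ ≤ C * (1 + s0.im ^ 2)⁻¹ * (1 + s1.im ^ 2)⁻¹ := by
  obtain ⟨C, hC, h⟩ := exists_norm_Gfun_le hre (M := M) hm
  have hpow : ∀ y : ℝ, 0 < y → ∃ B : ℝ, ∀ x ∈ Icc m M, ‖y ^ (1 - x)‖ ≤ B := fun y hy =>
    isCompact_Icc.exists_bound_of_continuousOn
      (continuous_const.rpow (by fun_prop) fun _ => Or.inl hy.ne').continuousOn
  obtain ⟨B0, hB0⟩ := hpow y0 hy0
  obtain ⟨B1, hB1⟩ := hpow y1 hy1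
  refine ⟨C * B0 * B1, fun s0 s1 hs0 hs1 => ?_⟩
  have e0 := (le_abs_self _).trans (hB0 _ hs0)
  have e1 := (le_abs_self _).trans (hB1 _ hs1)
  have p0 : 0 ≤ B0 := (norm_nonneg _).trans (hB0 _ hs0)
  rw [norm_whittakerIntegrand α hy0 hy1]
  calc _ ≤ (C * ((1 + s0.im ^ 2)⁻¹ * (1 + s1.im ^ 2)⁻¹)) * B0 * B1 := by
        gcongr
        exact h s0 s1 hs0 hs1
    _ = _ := by ring

/-- The Mellin–Barnes integral may be moved to any pair of lines in the right half-plane. -/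
lemma integral_whittakerIntegrand_eq {α : Fin 3 → ℂ} (hre : ∀ i, (α i).re = 0)
    {y0 y1 : ℝ} (hy0 : 0 < y0) (hy1 : 0 < y1) {a0 a1 b0 b1 : ℝ}
    (ha0 : 0 < a0) (ha1 : 0 < a1) (hb0 : 0 < b0) (hb1 : 0 < b1) :
    ∫ t0 : ℝ, ∫ t1 : ℝ, whittakerIntegrand α y0 y1 (a0 + t0 * I) (a1 + t1 * I) =
      ∫ t1 : ℝ, ∫ t0 : ℝ, whittakerIntegrand α y0 y1 (b0 + t0 * I) (b1 + t1 * I) := by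
  set m := min (min a0 b0) (min a1 b1)
  set M := max (max a0 b0) (max a1 b1)
  have hm : 0 < m := by simp [m, *]
  have hsub0 : uIcc a0 b0 ⊆ Icc m M := Icc_subset_Icc (min_le_left _ _) (le_max_left _ _)
  have hsub1 : uIcc a1 b1 ⊆ Icc m M := Icc_subset_Icc (min_le_right _ _) (le_max_right _ _)
  obtain ⟨C, hC⟩ := exists_norm_whittakerIntegrand_le hre hy0 hy1 (M := M) hm
  have hd : ∀ s0 s1 : ℂ, s0.re ∈ Icc m M → s1.re ∈ Icc m M →
      DifferentiableAt ℂ (fun p : ℂ × ℂ => whittakerIntegrand α y0 y1 p.1 p.2) (s0, s1) :=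
    fun s0 s1 h0 h1 => differentiableAt_whittakerIntegrand hre hy0 hy1
      (hm.trans_le h0.1) (hm.trans_le h1.1)
  have ma0 : a0 ∈ Icc m M := hsub0 left_mem_uIcc
  have mb1 : b1 ∈ Icc m M := hsub1 right_mem_uIcc
  have hinner : ∀ t0 : ℝ, ∫ t1 : ℝ, whittakerIntegrand α y0 y1 (a0 + t0 * I) (a1 + t1 * I) =
      ∫ t1 : ℝ, whittakerIntegrand α y0 y1 (a0 + t0 * I) (b1 + t1 * I) := by
    intro t0
    have h0 : ((a0 : ℂ) + t0 * I).re ∈ Icc m M := by simpa using ma0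
    exact integral_vertical_line_eq (f := whittakerIntegrand α y0 y1 (a0 + t0 * I))
      (fun s hs => (hd _ s h0 (hsub1 hs)).comp (f := fun s : ℂ => ((a0 : ℂ) + t0 * I, s)) s
        (by fun_prop))
      (fun s hs => hC _ s h0 (hsub1 hs))
  have houter : ∀ t1 : ℝ, ∫ t0 : ℝ, whittakerIntegrand α y0 y1 (a0 + t0 * I) (b1 + t1 * I) =
      ∫ t0 : ℝ, whittakerIntegrand α y0 y1 (b0 + t0 * I) (b1 + t1 * I) := by
    intro t1
    have h1 : ((b1 : ℂ) + t1 * I).re ∈ Icc m M := by simpa using mb1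
    exact integral_vertical_line_eq (f := fun s => whittakerIntegrand α y0 y1 s (b1 + t1 * I))
      (C := C * (1 + ((b1 : ℂ) + t1 * I).im ^ 2)⁻¹)
      (fun s hs => (hd s _ (hsub0 hs) h1).comp (f := fun s : ℂ => (s, (b1 : ℂ) + t1 * I)) s
        (by fun_prop))
      (fun s hs => (hC s _ (hsub0 hs) h1).trans_eq (by ring))
  have hintegrable : Integrable (Function.uncurry fun t0 t1 : ℝ =>
      whittakerIntegrand α y0 y1 (a0 + t0 * I) (b1 + t1 * I)) (volume.prod volume) := by
    have hcont : Continuous (Function.uncurry fun t0 t1 : ℝ =>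
        whittakerIntegrand α y0 y1 (a0 + t0 * I) (b1 + t1 * I)) := by
      refine continuous_iff_continuousAt.mpr fun t => ?_
      exact ContinuousAt.comp
        (f := fun t : ℝ × ℝ => ((a0 : ℂ) + t.1 * I, (b1 : ℂ) + t.2 * I))
        (hd _ _ (by simpa using ma0) (by simpa using mb1)).continuousAt (by fun_prop)
    refine ((integrable_inv_one_add_sq.mul_prod integrable_inv_one_add_sq).const_mul C).mono'
      hcont.aestronglyMeasurable (Filter.Eventually.of_forall fun t => ?_)
    have h := hC (a0 + t.1 * I) (b1 + t.2 * I) (by simpa using ma0) (by simpa using mb1)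
    simpa [Function.uncurry, mul_assoc] using h
  simp_rw [hinner]
  rw [integral_integral_swap hintegrable]
  simp_rw [houter]

/-- Bound for the GL(3) Whittaker function: `|W_{−α}(y₀,y₁)| ≤ C y₀^{A₀} y₁^{A₁}` for
any `A₀, A₁ < 1`. -/
theorem gl3_whittaker_bound (α : Fin 3 → ℂ)
    (hre : ∀ i, (α i).re = 0) (hsum : α 0 + α 1 + α 2 = 0)
    (A0 A1 : ℝ) (hA0 : A0 < 1) (hA1 : A1 < 1) :
    ∃ C : ℝ, 0 < C ∧ ∀ y0 y1 : ℝ, 0 < y0 → 0 < y1 →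
      ‖W3 α y0 y1‖ ≤ C * y0 ^ A0 * y1 ^ A1 := by
  have hb0 : 0 < 1 - A0 := sub_pos.mpr hA0
  have hb1 : 0 < 1 - A1 := sub_pos.mpr hA1
  obtain ⟨C, hC, hG⟩ := exists_norm_Gfun_le hre (m := min (1 - A0) (1 - A1))
    (M := max (1 - A0) (1 - A1)) (lt_min hb0 hb1)
  set κ : ℂ := (1 / 4) * (1 / (2 * (Real.pi : ℂ))) ^ 2 with hκ
  refine ⟨(‖κ‖ + 1) * (C * Real.pi ^ 2), by positivity, fun y0 y1 hy0 hy1 => ?_⟩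
  have hW : W3 α y0 y1 = κ * ∫ t1 : ℝ, ∫ t0 : ℝ,
      whittakerIntegrand α y0 y1 ((1 - A0 : ℝ) + t0 * I) ((1 - A1 : ℝ) + t1 * I) := by
    rw [← integral_whittakerIntegrand_eq hre hy0 hy1 one_pos one_pos hb0 hb1]
    simp [W3, whittakerIntegrand, hκ]
  have hpt : ∀ t0 t1 : ℝ,
      ‖whittakerIntegrand α y0 y1 ((1 - A0 : ℝ) + t0 * I) ((1 - A1 : ℝ) + t1 * I)‖ ≤
        C * y0 ^ A0 * y1 ^ A1 * (1 + t1 ^ 2)⁻¹ * (1 + t0 ^ 2)⁻¹ := by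
    intro t0 t1
    have h := hG ((1 - A0 : ℝ) + t0 * I) ((1 - A1 : ℝ) + t1 * I) (by simp) (by simp)
    have i0 : (((1 - A0 : ℝ) : ℂ) + t0 * I).im = t0 := by simp
    have i1 : (((1 - A1 : ℝ) : ℂ) + t1 * I).im = t1 := by simp
    have r0 : 1 - (((1 - A0 : ℝ) : ℂ) + t0 * I).re = A0 := by simp
    have r1 : 1 - (((1 - A1 : ℝ) : ℂ) + t1 * I).re = A1 := by simp
    rw [i0, i1] at h
    rw [norm_whittakerIntegrand α hy0 hy1, r0, r1]
    calc _ ≤ C * ((1 + t0 ^ 2)⁻¹ * (1 + t1 ^ 2)⁻¹) * y0 ^ A0 * y1 ^ A1 := by gcongr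
      _ = _ := by ring
  have hintegrable : ‖∫ t1 : ℝ, ∫ t0 : ℝ,
      whittakerIntegrand α y0 y1 ((1 - A0 : ℝ) + t0 * I) ((1 - A1 : ℝ) + t1 * I)‖ ≤
        C * Real.pi ^ 2 * y0 ^ A0 * y1 ^ A1 := by
    have hin : ∀ t1 : ℝ, ‖∫ t0 : ℝ,
        whittakerIntegrand α y0 y1 ((1 - A0 : ℝ) + t0 * I) ((1 - A1 : ℝ) + t1 * I)‖ ≤
          C * y0 ^ A0 * y1 ^ A1 * Real.pi * (1 + t1 ^ 2)⁻¹ := by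
      intro t1
      refine (norm_integral_le_of_norm_le (integrable_inv_one_add_sq.const_mul _)
        (Filter.Eventually.of_forall fun t0 => hpt t0 t1)).trans_eq ?_
      rw [integral_const_mul, integral_univ_inv_one_add_sq]
      ring
    refine (norm_integral_le_of_norm_le (integrable_inv_one_add_sq.const_mul _)
      (Filter.Eventually.of_forall hin)).trans_eq ?_
    rw [integral_const_mul, integral_univ_inv_one_add_sq]
    ring
  rw [hW, norm_mul]
  calc _ ≤ (‖κ‖ + 1) * (C * Real.pi ^ 2 * y0 ^ A0 * y1 ^ A1) := by gcongr; linarith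
    _ = _ := by ring
end

section
/- Diagonal evaluation: Fix η > 40, H ∈ C_η, h := H^♭, and α = (α₁, α₂, α₃) ∈ ℂ³ with Re α_i = 0 and α₁ + α₂ + α₃ = 0. Then for every s ∈ ℂ with 7/10 < Re s < 4, ∫₀^∞ ∫₀^∞ h(y₁) · (y₀² y₁)^{s−1/2} · W_{−α}(y₀, y₁) dy₀ dy₁/(y₀ y₁²) = (π^{−3s}/8) · (1/(2π)) ∫_ℝ (H(it)/(Γ(it)Γ(−it))) · ∏_{i=1}^{3} Γ((s + it − α_i)/2) Γ((s − it − α_i)/2) dt. -/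
open Complex MeasureTheory Set

/-- The K-Bessel function `K_μ(x) = ∫₀^∞ exp(−x cosh t) cosh(μt) dt`. -/
noncomputable def KBessel (μ : ℂ) (x : ℝ) : ℂ :=
  ∫ t in Ioi (0:ℝ), Complex.exp (-(x : ℂ) * (Real.cosh t : ℂ)) * Complex.cosh (μ * (t : ℂ))

/-- The GL(2) Whittaker function `W_μ(y) = 2√y K_μ(2πy)`. -/
noncomputable def W2 (μ : ℂ) (y : ℝ) : ℂ :=
  2 * (Real.sqrt y : ℂ) * KBessel μ (2 * Real.pi * y)

/-- The class `C_η` of test functions. -/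
def MemCeta (η : ℝ) (H : ℂ → ℂ) : Prop :=
  DifferentiableOn ℂ H {μ : ℂ | |μ.re| < 2 * η} ∧
  (∀ μ : ℂ, |μ.re| < 2 * η → H (-μ) = H μ) ∧
  ∃ C : ℝ, ∀ μ : ℂ, |μ.re| < 2 * η → ‖H μ‖ ≤ C * Real.exp (-2 * Real.pi * |μ.im|)

/-- The inverse Kontorovich–Lebedev transform. -/
noncomputable def Hflat (H : ℂ → ℂ) (y : ℝ) : ℂ :=
  (1 / (4 * (Real.pi : ℂ))) * ∫ t : ℝ,
    H (t * I) * W2 (t * I) y / (Complex.Gamma (t * I) * Complex.Gamma (-(t * I)))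

/-- The density of `GammaR` in the logarithmic variable: `∫ gammaDensity a = GammaR a`. -/
noncomputable def gammaDensity (a : ℂ) (ξ : ℝ) : ℂ :=
  2 * Complex.exp (a * ξ - Real.pi * Real.exp (2 * ξ))

/-- `log (1 + eˣ)`. -/
noncomputable def softplus (x : ℝ) : ℝ := Real.log (1 + Real.exp x)

theorem exp_softplus (x : ℝ) : Real.exp (softplus x) = 1 + Real.exp x :=
  Real.exp_log (by positivity)

theorem continuous_softplus : Continuous softplus :=
  Continuous.log (by fun_prop) fun x => by positivity

theorem softplus_nonneg (x : ℝ) : 0 ≤ softplus x :=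
  Real.log_nonneg (by linarith [Real.exp_pos x])

theorem continuous_gammaDensity (a : ℂ) : Continuous (gammaDensity a) := by
  unfold gammaDensity; fun_prop

theorem norm_gammaDensity (a : ℂ) (ξ : ℝ) :
    ‖gammaDensity a ξ‖ = 2 * Real.exp (a.re * ξ - Real.pi * Real.exp (2 * ξ)) := by
  rw [gammaDensity, norm_mul, Complex.norm_exp]
  simp [← ofReal_mul, -ofReal_exp]

theorem gammaDensity_ofReal (a ξ : ℝ) :
    gammaDensity a ξ = ((2 * Real.exp (a * ξ - Real.pi * Real.exp (2 * ξ)) : ℝ) : ℂ) := by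
  simp [gammaDensity]

theorem gammaDensity_re_eq_norm (a : ℂ) (ξ : ℝ) :
    gammaDensity (a.re : ℂ) ξ = (‖gammaDensity a ξ‖ : ℂ) := by
  rw [gammaDensity_ofReal, norm_gammaDensity]

theorem image_pi_mul_exp_two_mul :
    Set.image (fun x : ℝ => Real.pi * Real.exp (2 * x)) univ = Ioi 0 := by
  ext y
  simp only [image_univ, mem_range, mem_Ioi]
  constructor
  · rintro ⟨x, rfl⟩; positivity
  · intro hy
    refine ⟨Real.log (y / Real.pi) / 2, ?_⟩
    rw [mul_div_cancel₀ _ two_ne_zero, Real.exp_log (by positivity)]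
    field_simp

theorem ofReal_cpow_eq_exp {x : ℝ} (hx : 0 < x) (z : ℂ) :
    (x : ℂ) ^ z = Complex.exp (Real.log x * z) := by
  rw [cpow_def_of_ne_zero (by exact_mod_cast hx.ne'), ofReal_log hx.le]

theorem ofReal_exp_cpow (x : ℝ) (z : ℂ) :
    ((Real.exp x : ℝ) : ℂ) ^ z = Complex.exp (x * z) := by
  rw [ofReal_cpow_eq_exp (Real.exp_pos x), Real.log_exp]

theorem gammaDensity_eq_smul (a : ℂ) (x : ℝ) :
    |Real.pi * (Real.exp (2 * x) * 2)| •
      (((Real.exp (-(Real.pi * Real.exp (2 * x))) : ℝ) : ℂ) *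
        ((Real.pi * Real.exp (2 * x) : ℝ) : ℂ) ^ (a / 2 - 1)) =
      (Real.pi : ℂ) ^ (a / 2) * gammaDensity a x := by
  have h : Real.pi * Real.exp (2 * x) = Real.exp (Real.log Real.pi + 2 * x) := by
    rw [Real.exp_add, Real.exp_log Real.pi_pos]
  have h2 : |Real.pi * (Real.exp (2 * x) * 2)| = 2 * Real.exp (Real.log Real.pi + 2 * x) := by
    rw [abs_of_pos (by positivity), ← h]; ring
  rw [h2, Complex.real_smul, h, ofReal_exp_cpow, ofReal_cpow_eq_exp Real.pi_pos, gammaDensity]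
  have h4 : Complex.exp (-(Real.pi * Complex.exp (2 * x))) =
      Complex.exp (-Complex.exp (Real.log Real.pi + 2 * x)) := by
    exact_mod_cast congrArg (fun y : ℝ => ((Real.exp (-y) : ℝ) : ℂ)) h
  push_cast
  rw [sub_eq_add_neg (a * x : ℂ), Complex.exp_add (a * x : ℂ), h4,
    show (Real.log Real.pi + 2 * x) * (a / 2 - 1) =
      Real.log Real.pi * (a / 2) + a * x - (Real.log Real.pi + 2 * x : ℂ) by ring,
    Complex.exp_sub, Complex.exp_add (Real.log Real.pi * (a / 2))]
  field_simp [Complex.exp_ne_zero]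

theorem hasDerivWithinAt_pi_mul_exp_two_mul (x : ℝ) :
    HasDerivWithinAt (fun x : ℝ => Real.pi * Real.exp (2 * x))
      (Real.pi * (Real.exp (2 * x) * 2)) univ x := by
  have := (((hasDerivAt_id x).const_mul 2).exp).const_mul Real.pi
  rw [hasDerivWithinAt_univ]
  simpa using this

theorem injOn_pi_mul_exp_two_mul :
    InjOn (fun x : ℝ => Real.pi * Real.exp (2 * x)) univ := by
  intro x _ y _ h
  simpa [Real.pi_ne_zero] using h

theorem integrable_gammaDensity {a : ℂ} (ha : 0 < a.re) : Integrable (gammaDensity a) := by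
  have h := GammaIntegral_convergent (s := a / 2) (by simpa using ha)
  rw [← image_pi_mul_exp_two_mul, integrableOn_image_iff_integrableOn_abs_deriv_smul
    MeasurableSet.univ (fun x _ => hasDerivWithinAt_pi_mul_exp_two_mul x)
    injOn_pi_mul_exp_two_mul, integrableOn_univ] at h
  simp_rw [gammaDensity_eq_smul] at h
  have hpi : (Real.pi : ℂ) ^ (a / 2) ≠ 0 := by simp [cpow_eq_zero_iff, Real.pi_ne_zero]
  simpa [hpi] using h.const_mul ((Real.pi : ℂ) ^ (a / 2))⁻¹

theorem integral_gammaDensity {a : ℂ} (ha : 0 < a.re) : ∫ x, gammaDensity a x = GammaR a := by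
  have hpi : (Real.pi : ℂ) ^ (a / 2) ≠ 0 := by simp [cpow_eq_zero_iff, Real.pi_ne_zero]
  have h : Complex.Gamma (a / 2) = (Real.pi : ℂ) ^ (a / 2) * ∫ x, gammaDensity a x := by
    rw [Complex.Gamma_eq_integral (by simpa using ha), GammaIntegral,
      ← image_pi_mul_exp_two_mul, integral_image_eq_integral_abs_deriv_smul
      MeasurableSet.univ (fun x _ => hasDerivWithinAt_pi_mul_exp_two_mul x)
      injOn_pi_mul_exp_two_mul, setIntegral_univ, ← integral_const_mul]
    simp_rw [gammaDensity_eq_smul]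
  rw [GammaR, h, neg_div, cpow_neg, inv_mul_cancel_left₀ hpi]

theorem GammaR_ne_zero_s10 {a : ℂ} (ha : 0 < a.re) : GammaR a ≠ 0 :=
  Gammaℝ_ne_zero_of_re_pos ha

theorem gammaDensity_mul_gammaDensity (a b : ℂ) (x w : ℝ) :
    gammaDensity a x * gammaDensity b (x + w) =
      2 * Complex.exp (b * w - (a + b) / 2 * softplus (2 * w)) *
        gammaDensity (a + b) (x + softplus (2 * w) / 2) := by
  have h : Real.exp (2 * (x + softplus (2 * w) / 2)) =
      Real.exp (2 * x) + Real.exp (2 * (x + w)) := by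
    rw [show 2 * (x + softplus (2 * w) / 2) = 2 * x + softplus (2 * w) by ring, Real.exp_add,
      exp_softplus, mul_add, ← Real.exp_add]
    ring_nf
  simp only [gammaDensity]
  rw [h, mul_mul_mul_comm, ← Complex.exp_add, mul_mul_mul_comm, ← Complex.exp_add]
  push_cast
  ring_nf

theorem integrable_gammaDensity_mul {a b : ℂ} (h : 0 < (a + b).re) (w : ℝ) :
    Integrable fun x => gammaDensity a x * gammaDensity b (x + w) := by
  simp_rw [gammaDensity_mul_gammaDensity]
  exact ((integrable_gammaDensity h).comp_add_right _).const_mul _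

theorem integral_gammaDensity_mul {a b : ℂ} (h : 0 < (a + b).re) (w : ℝ) :
    ∫ x, gammaDensity a x * gammaDensity b (x + w) =
      2 * Complex.exp (b * w - (a + b) / 2 * softplus (2 * w)) * GammaR (a + b) := by
  simp_rw [gammaDensity_mul_gammaDensity]
  rw [integral_const_mul, integral_add_right_eq_self (gammaDensity (a + b)),
    integral_gammaDensity h]

/-- The integrand of the Beta integral in the logarithmic variable. -/
noncomputable def betaDensity (a b : ℂ) (τ : ℝ) : ℂ :=
  Complex.exp (a / 2 * τ - (a + b) / 2 * softplus τ)

theorem measurePreserving_shear {g : ℝ → ℝ} (hg : Continuous g) :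
    MeasurePreserving (fun p : ℝ × ℝ => (p.1, p.2 + g p.1)) := by
  refine (MeasurePreserving.id volume).skew_product (g := fun x y => y + g x) ?_ ?_
  · exact (by fun_prop : Continuous (Function.uncurry fun x y : ℝ => y + g x)).measurable
  · exact ae_of_all _ fun x => map_add_right_eq_self volume (g x)

theorem integrable_betaDensity_and_integral {a b : ℂ} (ha : 0 < a.re) (hb : 0 < b.re) :
    Integrable (betaDensity a b) ∧
      ∫ τ, betaDensity a b τ = GammaR a * GammaR b / GammaR (a + b) := by
  have hne := GammaR_ne_zero_s10 (a := b + a) (by simp; linarith)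
  have h1 : Integrable fun p : ℝ × ℝ => gammaDensity b p.1 * gammaDensity a p.2 :=
    (integrable_gammaDensity hb).mul_prod (integrable_gammaDensity ha)
  have h2 : Integrable fun p : ℝ × ℝ => gammaDensity b p.1 * gammaDensity a (p.2 + p.1) :=
    ((measurePreserving_shear continuous_id).integrable_comp h1.aestronglyMeasurable).2 h1
  have h3 : ∫ p : ℝ × ℝ, gammaDensity b p.1 * gammaDensity a (p.2 + p.1) =
      ∫ p : ℝ × ℝ, gammaDensity b p.1 * gammaDensity a p.2 := by
    have hm := measurePreserving_shear continuous_id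
    conv_rhs => rw [← hm.map_eq, integral_map hm.aemeasurable
      (by rw [hm.map_eq]; exact h1.aestronglyMeasurable)]
    rfl
  have h4 : ∀ w : ℝ, ∫ x, gammaDensity b x * gammaDensity a (w + x) =
      (2 * GammaR (b + a)) * betaDensity a b (2 * w) := by
    intro w
    have := integral_gammaDensity_mul (a := b) (b := a) (by simp; linarith) w
    simp_rw [add_comm w, this, betaDensity]
    push_cast
    ring_nf
  have h5 := h2.integral_prod_right
  simp_rw [h4] at h5
  have h6 : Integrable fun w : ℝ => betaDensity a b (2 * w) := by
    refine (h5.const_mul (2 * GammaR (b + a))⁻¹).congr (ae_of_all _ fun w => ?_)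
    exact inv_mul_cancel_left₀ (mul_ne_zero two_ne_zero hne) _
  refine ⟨(integrable_comp_mul_left_iff _ two_ne_zero).1 h6, ?_⟩
  have h7 : ∫ p : ℝ × ℝ, gammaDensity b p.1 * gammaDensity a (p.2 + p.1) =
      GammaR (b + a) * ∫ τ, betaDensity a b τ := by
    rw [Measure.volume_eq_prod, integral_prod_symm _ h2]
    simp_rw [h4]
    rw [integral_const_mul, Measure.integral_comp_mul_left]
    simp
    ring
  rw [h3, Measure.volume_eq_prod, integral_prod_mul, integral_gammaDensity ha,
    integral_gammaDensity hb] at h7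
  rw [add_comm a b, eq_div_iff hne, mul_comm _ (GammaR (b + a)), ← h7, mul_comm]

/-- The function with Mellin transform `s ↦ GammaR (s + a) * GammaR (s + b)`, in the logarithmic
variable. It is a multiple of a K-Bessel function. -/
noncomputable def besselKernel (a b : ℂ) (η : ℝ) : ℂ :=
  ∫ ξ : ℝ, gammaDensity a ξ * gammaDensity b (η - ξ)

theorem gammaDensity_add (a s : ℂ) (x : ℝ) :
    gammaDensity (a + s) x = Complex.exp (s * x) * gammaDensity a x := by
  rw [gammaDensity, gammaDensity, mul_left_comm, ← Complex.exp_add]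
  ring_nf

theorem besselKernel_add (a b s : ℂ) (η : ℝ) :
    besselKernel (a + s) (b + s) η = Complex.exp (s * η) * besselKernel a b η := by
  rw [besselKernel, besselKernel, ← integral_const_mul]
  congr 1 with ξ
  rw [gammaDensity_add, gammaDensity_add, mul_mul_mul_comm, ← Complex.exp_add]
  push_cast
  ring_nf

theorem stronglyMeasurable_besselKernel :
    StronglyMeasurable fun p : (ℂ × ℂ) × ℝ => besselKernel p.1.1 p.1.2 p.2 := by
  refine StronglyMeasurable.integral_prod_right
    (f := fun (p : (ℂ × ℂ) × ℝ) ξ => gammaDensity p.1.1 ξ * gammaDensity p.1.2 (p.2 - ξ)) ?_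
  refine Continuous.stronglyMeasurable ?_
  unfold gammaDensity Function.uncurry
  fun_prop

theorem besselKernel_re_eq (a b : ℂ) (η : ℝ) :
    besselKernel (a.re : ℂ) (b.re : ℂ) η =
      ((∫ ξ : ℝ, ‖gammaDensity a ξ * gammaDensity b (η - ξ)‖ : ℝ) : ℂ) := by
  rw [besselKernel, ← integral_complex_ofReal]
  simp_rw [gammaDensity_re_eq_norm, norm_mul, ofReal_mul]

theorem norm_besselKernel_re (a b : ℂ) (η : ℝ) :
    (‖besselKernel (a.re : ℂ) (b.re : ℂ) η‖ : ℂ) = besselKernel (a.re : ℂ) (b.re : ℂ) η := by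
  rw [besselKernel_re_eq, norm_real, Real.norm_of_nonneg (by positivity)]

theorem norm_besselKernel_le (a b : ℂ) (η : ℝ) :
    ‖besselKernel a b η‖ ≤ ‖besselKernel (a.re : ℂ) (b.re : ℂ) η‖ := by
  rw [besselKernel_re_eq, norm_real, Real.norm_of_nonneg (by positivity)]
  exact norm_integral_le_integral_norm _

theorem besselKernel_eq_convolution (a b : ℂ) :
    besselKernel a b = convolution (gammaDensity a) (gammaDensity b)
      (ContinuousLinearMap.mul ℂ ℂ) volume := by
  ext η; rfl

theorem integrable_besselKernel {a b : ℂ} (ha : 0 < a.re) (hb : 0 < b.re) :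
    Integrable (besselKernel a b) := by
  rw [besselKernel_eq_convolution]
  exact (integrable_gammaDensity ha).integrable_convolution _ (integrable_gammaDensity hb)

theorem integral_besselKernel {a b : ℂ} (ha : 0 < a.re) (hb : 0 < b.re) :
    ∫ η, besselKernel a b η = GammaR a * GammaR b := by
  rw [besselKernel_eq_convolution, integral_convolution _ (integrable_gammaDensity ha)
    (integrable_gammaDensity hb), integral_gammaDensity ha, integral_gammaDensity hb]
  rfl

theorem bddAbove_norm_gammaDensity {b : ℂ} (hb : 0 < b.re) :
    BddAbove (range fun x => ‖gammaDensity b x‖) := by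
  refine ⟨2 * Real.exp (b.re ^ 2), ?_⟩
  rintro _ ⟨x, rfl⟩
  dsimp only
  rw [norm_gammaDensity]
  gcongr
  have hpi := Real.pi_gt_three
  rcases le_total x 0 with hx | hx
  · have : b.re * x ≤ 0 := mul_nonpos_of_nonneg_of_nonpos hb.le hx
    nlinarith [Real.exp_pos (2 * x), sq_nonneg b.re]
  · have h1 := Real.quadratic_le_exp_of_nonneg (x := 2 * x) (by linarith)
    have h2 : 3 * Real.exp (2 * x) ≤ Real.pi * Real.exp (2 * x) := by gcongr
    nlinarith [sq_nonneg (b.re - x), sq_nonneg b.re]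

theorem continuous_besselKernel {a b : ℂ} (ha : 0 < a.re) (hb : 0 < b.re) :
    Continuous (besselKernel a b) := by
  rw [besselKernel_eq_convolution]
  exact (bddAbove_norm_gammaDensity hb).continuous_convolution_right_of_integrable _
    (integrable_gammaDensity ha) (continuous_gammaDensity b)

theorem continuous_GammaR_vertical {a : ℂ} (ha : 0 < a.re) :
    Continuous fun t : ℝ => GammaR (a + t * I) := by
  unfold GammaR
  refine Continuous.mul ?_ ?_
  · simp_rw [ofReal_cpow_eq_exp Real.pi_pos]
    fun_prop
  · refine continuous_iff_continuousAt.2 fun t => ?_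
    have h : DifferentiableAt ℂ Complex.Gamma ((a + t * I) / 2) := by
      refine differentiableAt_Gamma _ fun m h => ?_
      have := congrArg Complex.re h
      simp at this
      have hm : (0 : ℝ) ≤ m := m.cast_nonneg
      linarith
    exact ContinuousAt.comp (f := fun t : ℝ => (a + t * I) / 2) h.continuousAt (by fun_prop)

theorem norm_GammaR_le_of_re_pos {a : ℂ} (ha : 0 < a.re) : ‖GammaR a‖ ≤ ‖GammaR (a.re : ℂ)‖ := by
  rw [← integral_gammaDensity ha, ← integral_gammaDensity (a := (a.re : ℂ)) (by simpa using ha)]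
  simp_rw [gammaDensity_re_eq_norm]
  rw [integral_complex_ofReal, norm_real, Real.norm_of_nonneg (by positivity)]
  exact norm_integral_le_integral_norm _

theorem exists_norm_GammaR_vertical_le {σ : ℝ} (hσ : 0 < σ) :
    ∃ C : ℝ, 0 ≤ C ∧ ∀ t : ℝ, ‖GammaR (σ + t * I)‖ ≤ C / Real.sqrt (σ ^ 2 + t ^ 2) := by
  refine ⟨2 * Real.pi * ‖GammaR ((σ + 2 : ℝ) : ℂ)‖, by positivity, fun t => ?_⟩
  set z : ℂ := σ + t * I with hz
  have hzre : z.re = σ := by simp [hz]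
  have hz0 : z ≠ 0 := fun h => by rw [h] at hzre; simp at hzre; linarith
  have h1 : GammaR (z + 2) = GammaR z * z / 2 / Real.pi := Gammaℝ_add_two hz0
  have h2 : ‖z‖ = Real.sqrt (σ ^ 2 + t ^ 2) := by
    rw [hz, norm_add_mul_I]
  have h3 := norm_GammaR_le_of_re_pos (a := z + 2) (by simp [hzre]; linarith)
  rw [← h2, le_div_iff₀ (norm_pos_iff.2 hz0)]
  have h4 : GammaR z * z = 2 * Real.pi * GammaR (z + 2) := by
    rw [h1]; field_simp [Real.pi_ne_zero]
  rw [← norm_mul, h4, norm_mul, norm_mul, norm_real, Real.norm_of_nonneg Real.pi_pos.le]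
  simp only [add_re, hzre, re_ofNat] at h3
  norm_num
  norm_num at h3
  gcongr

theorem integrable_GammaR_mul_vertical {a b : ℂ} (ha : a.re = 1) (hb : b.re = 1) :
    Integrable fun t : ℝ => GammaR (a + t * I) * GammaR (b + t * I) := by
  obtain ⟨C, hC, h⟩ := exists_norm_GammaR_vertical_le one_pos
  have hi : Integrable fun t : ℝ => C ^ 2 * ((1 + (t + a.im) ^ 2)⁻¹ + (1 + (t + b.im) ^ 2)⁻¹) :=
    ((integrable_inv_one_add_sq.comp_add_right a.im).add
      (integrable_inv_one_add_sq.comp_add_right b.im)).const_mul _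
  refine hi.mono' ((continuous_GammaR_vertical (by rw [ha]; norm_num)).mul
    (continuous_GammaR_vertical (by rw [hb]; norm_num))).aestronglyMeasurable
    (ae_of_all _ fun t => ?_)
  have key : ∀ c : ℂ, c.re = 1 → ‖GammaR (c + t * I)‖ ≤ C / Real.sqrt (1 + (t + c.im) ^ 2) := by
    intro c hc
    have := h (t + c.im)
    convert! this using 3
    · apply Complex.ext <;> simp [hc, add_comm]
    · simp
  rw [norm_mul]
  have hA : 0 < 1 + (t + a.im) ^ 2 := by positivity
  have hB : 0 < 1 + (t + b.im) ^ 2 := by positivity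
  calc _ ≤ (C / Real.sqrt (1 + (t + a.im) ^ 2)) * (C / Real.sqrt (1 + (t + b.im) ^ 2)) := by
        gcongr
        exacts [key a ha, key b hb]
    _ = C ^ 2 * ((Real.sqrt (1 + (t + a.im) ^ 2))⁻¹ * (Real.sqrt (1 + (t + b.im) ^ 2))⁻¹) := by
        field_simp
    _ ≤ _ := by
        gcongr
        rw [← Real.sq_sqrt hA.le, ← Real.sq_sqrt hB.le, Real.sqrt_sq (by positivity),
          Real.sqrt_sq (by positivity), ← inv_pow, ← inv_pow]
        nlinarith [sq_nonneg ((Real.sqrt (1 + (t + a.im) ^ 2))⁻¹ -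
          (Real.sqrt (1 + (t + b.im) ^ 2))⁻¹), sq_nonneg (Real.sqrt (1 + (t + a.im) ^ 2))⁻¹,
          sq_nonneg (Real.sqrt (1 + (t + b.im) ^ 2))⁻¹]

theorem integral_GammaR_mul_vertical {a b : ℂ} (ha : a.re = 1) (hb : b.re = 1) (η : ℝ) :
    ∫ t : ℝ, GammaR (a + t * I) * GammaR (b + t * I) * Complex.exp (-(t * I) * η) =
      2 * Real.pi * besselKernel a b η := by
  have ha' : 0 < a.re := by rw [ha]; norm_num
  have hb' : 0 < b.re := by rw [hb]; norm_num
  have hF : FourierTransform.fourier (besselKernel a b) = fun v : ℝ =>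
      GammaR (a + (-2 * Real.pi * v : ℝ) * I) * GammaR (b + (-2 * Real.pi * v : ℝ) * I) := by
    ext v
    rw [Real.fourier_real_eq_integral_exp_smul, ← integral_besselKernel (by simpa using ha')
      (by simpa using hb')]
    congr 1 with u
    rw [besselKernel_add, smul_eq_mul]
    push_cast
    ring_nf
  have hpi : (-2 * Real.pi) ≠ 0 := by simp [Real.pi_ne_zero]
  have hint := (integrable_comp_mul_left_iff _ hpi).2 (integrable_GammaR_mul_vertical ha hb)
  have hinv := (integrable_besselKernel ha' hb').fourierInv_fourier_eq (by rw [hF]; exact hint)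
    (continuous_besselKernel ha' hb').continuousAt (v := η)
  rw [← hinv, hF, Real.fourierInv_eq']
  have := Measure.integral_comp_mul_left (fun t : ℝ =>
    GammaR (a + t * I) * GammaR (b + t * I) * Complex.exp (-(t * I) * η)) (-2 * Real.pi)
  have habs : |(-2 * Real.pi)⁻¹| = (2 * Real.pi)⁻¹ := by
    rw [abs_inv, abs_mul, abs_of_pos Real.pi_pos]; norm_num
  rw [habs, Complex.real_smul] at this
  have h2 : (2 * Real.pi : ℂ) * (((2 * Real.pi)⁻¹ : ℝ) : ℂ) = 1 := by
    push_cast; field_simp [Real.pi_ne_zero]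
  rw [← one_mul (∫ t : ℝ, _), ← h2, mul_assoc, ← this]
  congr 2 with v
  simp
  ring_nf

theorem integrable_besselKernel_integrand (a b : ℂ) (η : ℝ) :
    Integrable fun ξ : ℝ => gammaDensity a ξ * gammaDensity b (η - ξ) := by
  set s : ℂ := ((|a.re| + |b.re| + 1 : ℝ) : ℂ) with hs
  have ha : 0 < (a + s).re := by
    simp only [hs, add_re, ofReal_re]; linarith [neg_abs_le a.re, abs_nonneg b.re]
  have hb : 0 < (b + s).re := by
    simp only [hs, add_re, ofReal_re]; linarith [neg_abs_le b.re, abs_nonneg a.re]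
  obtain ⟨C, hC⟩ := bddAbove_norm_gammaDensity hb
  have h : Integrable fun ξ : ℝ => gammaDensity (a + s) ξ * gammaDensity (b + s) (η - ξ) :=
    (integrable_gammaDensity ha).mul_bdd (c := C)
      ((continuous_gammaDensity _).comp (by fun_prop)).aestronglyMeasurable
      (ae_of_all _ fun ξ => hC ⟨η - ξ, rfl⟩)
  refine (h.const_mul (Complex.exp (-(s * η)))).congr (ae_of_all _ fun ξ => ?_)
  simp only [gammaDensity_add]
  rw [mul_mul_mul_comm (Complex.exp _), ← Complex.exp_add, ← mul_assoc, ← Complex.exp_add]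
  push_cast
  ring_nf
  simp

theorem KBessel_eq_besselKernel (μ : ℂ) (η : ℝ) :
    KBessel μ (2 * Real.pi * Real.exp η) = besselKernel μ (-μ) η / 4 := by
  set g : ℝ → ℂ := fun t =>
    Complex.exp (-((2 * Real.pi * Real.exp η : ℝ) : ℂ) * (Real.cosh t : ℂ) + μ * t) with hg
  have h1 : ∀ ξ : ℝ, gammaDensity μ ξ * gammaDensity (-μ) (η - ξ) = 4 * g (2 * ξ + -η) := by
    intro ξ
    have he : 2 * Real.pi * Real.exp η * Real.cosh (2 * ξ + -η) =
        Real.pi * Real.exp (2 * ξ) + Real.pi * Real.exp (2 * (η - ξ)) := by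
      rw [Real.cosh_eq]
      have e1 : Real.exp η * Real.exp (2 * ξ + -η) = Real.exp (2 * ξ) := by
        rw [← Real.exp_add]; ring_nf
      have e2 : Real.exp η * Real.exp (-(2 * ξ + -η)) = Real.exp (2 * (η - ξ)) := by
        rw [← Real.exp_add]; ring_nf
      rw [← e1, ← e2]; ring
    simp only [hg, gammaDensity]
    rw [mul_mul_mul_comm, ← Complex.exp_add,
      neg_mul ((2 * Real.pi * Real.exp η : ℝ) : ℂ), ← ofReal_mul (2 * Real.pi * Real.exp η), he]
    push_cast
    ring_nf
  have hi : Integrable g := by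
    have h := (integrable_besselKernel_integrand μ (-μ) η).const_mul (1 / 4)
    simp_rw [h1] at h
    have h2 : Integrable fun ξ : ℝ => g (2 * ξ + -η) := by simpa using h
    have h3 := (integrable_comp_mul_left_iff (fun x => g (x + -η)) two_ne_zero).1 h2
    simpa using h3.comp_add_right η
  have h2 : besselKernel μ (-μ) η = 2 * ∫ t, g t := by
    simp_rw [besselKernel, h1]
    rw [integral_const_mul, Measure.integral_comp_mul_left (fun x => g (x + -η)),
      integral_add_right_eq_self g]
    simp
    ring
  have h3 : ∫ t, g t = 2 * KBessel μ (2 * Real.pi * Real.exp η) := by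
    rw [← intervalIntegral.integral_Iic_add_Ioi (b := 0) hi.integrableOn hi.integrableOn]
    have hneg := integral_comp_neg_Ioi 0 g
    rw [neg_zero] at hneg
    rw [← hneg, ← integral_add hi.comp_neg.integrableOn hi.integrableOn, KBessel,
      ← integral_const_mul]
    refine integral_congr_ae (ae_of_all _ fun t => ?_)
    simp only [hg, Complex.cosh, Real.cosh_neg, Complex.exp_add, ofReal_neg, mul_neg]
    ring
  rw [h2, h3]; ring

theorem W2_eq_besselKernel (μ : ℂ) (η : ℝ) :
    W2 μ (Real.exp η) = Complex.exp (η / 2) / 2 * besselKernel μ (-μ) η := by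
  rw [W2, KBessel_eq_besselKernel, Real.sqrt_eq_rpow, ← Real.exp_mul]
  push_cast
  ring_nf

theorem betaDensity_add_mul_I (a b : ℂ) (t u τ : ℝ) :
    betaDensity (a + t * I) (b + u * I) τ = betaDensity a b τ *
      (Complex.exp (-(t * I) * ((softplus τ - τ) / 2 : ℝ)) *
        Complex.exp (-(u * I) * (softplus τ / 2 : ℝ))) := by
  simp only [betaDensity, ← Complex.exp_add]
  push_cast
  ring_nf

theorem Gfun_eq {α : Fin 3 → ℂ} (hre : ∀ i, (α i).re = 0) {s₀ s₁ : ℂ}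
    (h₀ : 0 < s₀.re) (h₁ : 0 < s₁.re) :
    Gfun α s₀ s₁ = (GammaR (s₀ + α 0) * GammaR (s₀ + α 1)) *
      (GammaR (s₁ - α 0) * GammaR (s₁ - α 1)) *
        ∫ τ, betaDensity (s₀ + α 2) (s₁ - α 2) τ := by
  rw [(integrable_betaDensity_and_integral (by simpa [hre] using h₀) (by simpa [hre] using h₁)).2,
    Gfun, Fin.prod_univ_three]
  ring_nf

theorem W3_eq_integral {α : Fin 3 → ℂ} (hre : ∀ i, (α i).re = 0) (η₀ η₁ : ℝ) :
    W3 α (Real.exp η₀) (Real.exp η₁) = 1 / 4 * ∫ τ : ℝ,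
      betaDensity (1 + α 2) (1 - α 2) τ *
        (besselKernel (1 + α 0) (1 + α 1) (η₀ + (softplus τ - τ) / 2) *
          besselKernel (1 - α 0) (1 - α 1) (η₁ + softplus τ / 2)) := by
  set A : ℝ → ℂ := fun t => GammaR (1 + α 0 + t * I) * GammaR (1 + α 1 + t * I) with hA
  set B : ℝ → ℂ := fun t => GammaR (1 - α 0 + t * I) * GammaR (1 - α 1 + t * I) with hB
  have hAi : Integrable A := integrable_GammaR_mul_vertical (by simp [hre]) (by simp [hre])
  have hBi : Integrable B := integrable_GammaR_mul_vertical (by simp [hre]) (by simp [hre])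
  have hβi : Integrable (betaDensity (1 + α 2) (1 - α 2)) :=
    (integrable_betaDensity_and_integral (by simp [hre]) (by simp [hre])).1
  have hsp := continuous_softplus
  set E : (ℝ × ℝ) × ℝ → ℂ := fun q =>
    Complex.exp (-(q.1.1 * I) * (η₀ + (softplus q.2 - q.2) / 2 : ℝ)) *
      Complex.exp (-(q.1.2 * I) * (η₁ + softplus q.2 / 2 : ℝ)) with hE
  have hEn : ∀ q, ‖E q‖ ≤ 1 := fun q => by
    simp [hE, Complex.norm_exp]
  have hF : Integrable (fun q : (ℝ × ℝ) × ℝ =>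
      (A q.1.1 * B q.1.2 * betaDensity (1 + α 2) (1 - α 2) q.2) * E q)
      ((volume.prod volume).prod volume) :=
    ((hAi.mul_prod hBi).mul_prod hβi).mul_bdd (c := 1)
      (Continuous.aestronglyMeasurable (by fun_prop)) (ae_of_all _ hEn)
  have h1 : ∀ t₀ t₁ : ℝ, Gfun α (1 + t₀ * I) (1 + t₁ * I) *
        ((Real.exp η₀ : ℝ) : ℂ) ^ (-(t₀ * I)) * ((Real.exp η₁ : ℝ) : ℂ) ^ (-(t₁ * I)) =
      ∫ τ, (A t₀ * B t₁ * betaDensity (1 + α 2) (1 - α 2) τ) * E ((t₀, t₁), τ) := by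
    intro t₀ t₁
    rw [Gfun_eq hre (by simp) (by simp), ofReal_exp_cpow, ofReal_exp_cpow,
      ← integral_const_mul, ← integral_mul_const, ← integral_mul_const]
    congr 1 with τ
    rw [show 1 + t₀ * I + α 2 = (1 + α 2) + t₀ * I by ring,
      show 1 + t₁ * I - α 2 = (1 - α 2) + t₁ * I by ring, betaDensity_add_mul_I]
    simp only [hA, hB, hE]
    rw [show 1 + t₀ * I + α 0 = (1 + α 0) + t₀ * I by ring,
      show 1 + t₀ * I + α 1 = (1 + α 1) + t₀ * I by ring,
      show 1 + t₁ * I - α 0 = (1 - α 0) + t₁ * I by ring,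
      show 1 + t₁ * I - α 1 = (1 - α 1) + t₁ * I by ring, ofReal_add η₀, ofReal_add η₁,
      mul_add (-(t₀ * I)), mul_add (-(t₁ * I)), Complex.exp_add, Complex.exp_add,
      mul_comm (η₀ : ℂ), mul_comm (η₁ : ℂ)]
    ring
  have h2 : ∀ τ : ℝ, ∫ p : ℝ × ℝ,
        (A p.1 * B p.2 * betaDensity (1 + α 2) (1 - α 2) τ) * E (p, τ) ∂(volume.prod volume) =
      betaDensity (1 + α 2) (1 - α 2) τ *
        ((2 * Real.pi * besselKernel (1 + α 0) (1 + α 1) (η₀ + (softplus τ - τ) / 2)) *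
        (2 * Real.pi * besselKernel (1 - α 0) (1 - α 1) (η₁ + softplus τ / 2))) := by
    intro τ
    rw [← integral_GammaR_mul_vertical (by simp [hre]) (by simp [hre]),
      ← integral_GammaR_mul_vertical (by simp [hre]) (by simp [hre]), ← integral_prod_mul,
      ← integral_const_mul]
    congr 1 with p
    simp only [hA, hB, hE]
    ring
  rw [W3]
  simp_rw [h1]
  rw [← integral_prod (fun p : ℝ × ℝ => ∫ τ, (A p.1 * B p.2 * betaDensity (1 + α 2) (1 - α 2) τ) *
    E (p, τ)) hF.integral_prod_left,
    integral_integral_swap (f := fun (p : ℝ × ℝ) τ =>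
      (A p.1 * B p.2 * betaDensity (1 + α 2) (1 - α 2) τ) * E (p, τ)) hF]
  simp_rw [h2]
  rw [mul_assoc (1 / 4 : ℂ), ← integral_const_mul]
  congr 2 with τ
  field_simp [Real.pi_ne_zero]

theorem integral_norm_gammaDensity_mul (a b : ℂ) (w : ℝ) :
    ∫ x, ‖gammaDensity a x * gammaDensity b (x + w)‖ =
      ‖Complex.exp (b * w - (a + b) / 2 * softplus (2 * w))‖ *
        (2 * ∫ x, ‖gammaDensity (a + b) x‖) := by
  simp_rw [gammaDensity_mul_gammaDensity, norm_mul]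
  rw [integral_const_mul, integral_add_right_eq_self (fun x => ‖gammaDensity (a + b) x‖)]
  norm_num
  ring

theorem integrable_besselKernel_mul_and_integral {a b c d : ℂ} {l : ℝ}
    (hac : 0 < (a + c).re) (hbd : 0 < (b + d).re)
    (hw : Integrable fun w : ℝ => Complex.exp (c * w - (a + c) / 2 * softplus (2 * w)) *
      Complex.exp (d * (l - w : ℝ) - (b + d) / 2 * softplus (2 * (l - w)))) :
    Integrable (fun η => besselKernel a b η * besselKernel c d (η + l)) ∧
      ∫ η, besselKernel a b η * besselKernel c d (η + l) =
        4 * GammaR (a + c) * GammaR (b + d) *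
          ∫ w : ℝ, Complex.exp (c * w - (a + c) / 2 * softplus (2 * w)) *
            Complex.exp (d * (l - w : ℝ) - (b + d) / 2 * softplus (2 * (l - w))) := by
  set F : (ℝ × ℝ) × ℝ → ℂ := fun q => (gammaDensity a q.1.1 * gammaDensity b (q.2 - q.1.1)) *
    (gammaDensity c q.1.2 * gammaDensity d (q.2 + l - q.1.2)) with hF
  set G : (ℝ × ℝ) × ℝ → ℂ := fun q => (gammaDensity a q.1.1 * gammaDensity c (q.1.1 + q.1.2)) *
    (gammaDensity b q.2 * gammaDensity d (q.2 + (l - q.1.2))) with hG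
  set Φ : (ℝ × ℝ) × ℝ → (ℝ × ℝ) × ℝ := fun q => ((q.1.1, q.1.2 + q.1.1), q.2 + q.1.1) with hΦ
  have hcont := continuous_gammaDensity
  have hΦm : MeasurePreserving Φ ((volume.prod volume).prod volume)
      ((volume.prod volume).prod volume) := by
    refine (measurePreserving_shear continuous_id).skew_product
      (g := fun (p : ℝ × ℝ) y => y + p.1) ?_ ?_
    · exact (by fun_prop : Continuous
        (Function.uncurry fun (p : ℝ × ℝ) (y : ℝ) => y + p.1)).measurable
    · exact ae_of_all _ fun x => map_add_right_eq_self volume x.1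
  have hFG : F ∘ Φ = G := by
    ext q
    simp only [hF, hG, hΦ, Function.comp]
    rw [add_sub_cancel_right, add_comm q.1.2 q.1.1,
      show q.2 + q.1.1 + l - (q.1.1 + q.1.2) = q.2 + (l - q.1.2) by ring]
    ring
  have hFc : Continuous F := by fun_prop
  have hGc : Continuous G := by fun_prop
  have hG2 : Integrable (fun p : ℝ × ℝ => (gammaDensity a p.1 * gammaDensity c (p.1 + p.2)) *
      Complex.exp (d * (l - p.2 : ℝ) - (b + d) / 2 * softplus (2 * (l - p.2))))
      (volume.prod volume) := by
    have hsp := continuous_softplus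
    refine (integrable_prod_iff' (Continuous.aestronglyMeasurable (by fun_prop))).2 ⟨?_, ?_⟩
    · exact ae_of_all _ fun w => (integrable_gammaDensity_mul hac w).mul_const
        (Complex.exp (d * (l - w : ℝ) - (b + d) / 2 * softplus (2 * (l - w))))
    · simp_rw [norm_mul _ (Complex.exp _), integral_mul_const, integral_norm_gammaDensity_mul]
      refine (hw.norm.mul_const (2 * ∫ x, ‖gammaDensity (a + c) x‖)).congr
        (ae_of_all _ fun w => ?_)
      simp only [norm_mul]
      ring
  have hGi : Integrable G ((volume.prod volume).prod volume) := by
    refine (integrable_prod_iff hGc.aestronglyMeasurable).2 ⟨?_, ?_⟩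
    · exact ae_of_all _ fun p => (integrable_gammaDensity_mul hbd (l - p.2)).const_mul
        (gammaDensity a p.1 * gammaDensity c (p.1 + p.2))
    · simp only [hG]
      simp_rw [norm_mul (gammaDensity a _ * gammaDensity c _), integral_const_mul,
        integral_norm_gammaDensity_mul]
      refine (hG2.norm.mul_const (2 * ∫ x, ‖gammaDensity (b + d) x‖)).congr
        (ae_of_all _ fun p => ?_)
      simp only [norm_mul]
      ring
  have hFi : Integrable F ((volume.prod volume).prod volume) :=
    (hΦm.integrable_comp hFc.aestronglyMeasurable).1 (hFG ▸ hGi)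
  have hK : ∀ η : ℝ, ∫ p : ℝ × ℝ, F (p, η) ∂(volume.prod volume) =
      besselKernel a b η * besselKernel c d (η + l) := fun η => by
    rw [besselKernel, besselKernel, ← integral_prod_mul]
  refine ⟨by simpa only [hK] using hFi.integral_prod_right, ?_⟩
  simp_rw [← hK]
  rw [← integral_prod_symm _ hFi, ← hΦm.map_eq, integral_map hΦm.aemeasurable
    hFc.aestronglyMeasurable]
  change ∫ q, (F ∘ Φ) q ∂_ = _
  rw [hFG, integral_prod _ hGi]
  simp only [hG]
  simp_rw [integral_const_mul, integral_gammaDensity_mul hbd]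
  have e1 : ∀ p : ℝ × ℝ, gammaDensity a p.1 * gammaDensity c (p.1 + p.2) *
      (2 * Complex.exp (d * (l - p.2 : ℝ) - (b + d) / 2 * softplus (2 * (l - p.2))) *
        GammaR (b + d)) = (2 * GammaR (b + d)) *
      ((gammaDensity a p.1 * gammaDensity c (p.1 + p.2)) *
      Complex.exp (d * (l - p.2 : ℝ) - (b + d) / 2 * softplus (2 * (l - p.2)))) := fun p => by ring
  simp_rw [e1]
  rw [integral_const_mul, integral_prod_symm _ hG2]
  simp_rw [integral_mul_const, integral_gammaDensity_mul hac]
  rw [← integral_const_mul, ← integral_const_mul]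
  congr 1 with w
  ring

theorem softplus_add_softplus {p q r : ℝ} (h : p = r + softplus q - q) :
    softplus (q + softplus p) = softplus q + softplus r := by
  rw [softplus, Real.exp_add, exp_softplus, mul_add, ← Real.exp_add, h,
    show q + (r + softplus q - q) = r + softplus q by ring, Real.exp_add, exp_softplus,
    softplus, softplus, ← Real.log_mul (by positivity) (by positivity)]
  ring_nf

theorem softplus_sub (p q : ℝ) :
    softplus (softplus (q + softplus p) - p) = softplus p + softplus q - p := by
  apply Real.exp_injective
  rw [exp_softplus, Real.exp_sub, Real.exp_sub, Real.exp_add, exp_softplus, exp_softplus,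
    exp_softplus, Real.exp_add, exp_softplus]
  field_simp
  ring

theorem softplus_neg (x : ℝ) : softplus (-x) = softplus x - x := by
  apply Real.exp_injective
  rw [Real.exp_sub, exp_softplus, exp_softplus, Real.exp_neg]
  field_simp
  ring

theorem softplus_mono : Monotone softplus := fun x y h =>
  Real.log_le_log (by positivity) (by gcongr)

/-- The two-variable integrand to which the second Barnes lemma reduces. -/
noncomputable def barnesDensity (s μ a b c : ℂ) (τ p : ℝ) : ℂ :=
  Complex.exp ((s + c / 2) * τ - s * softplus τ) *
    (Complex.exp (-a * (p / 2) - (s + μ - a) / 2 * softplus p) *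
      Complex.exp (-b * ((softplus τ - p) / 2) - (s - μ - b) / 2 * softplus (softplus τ - p)))

theorem barnesDensity_eq {s μ a b c : ℂ} (h : a + b + c = 0) (q r : ℝ) :
    barnesDensity s μ a b c (q + softplus (r + softplus q - q)) (r + softplus q - q) =
      betaDensity (s + μ - b) (s - μ - c) q * betaDensity (s - μ - a) (s + μ - c) r := by
  have hc : c = -a - b := by linear_combination h
  rw [barnesDensity, softplus_sub, softplus_add_softplus rfl]
  simp only [betaDensity, ← Complex.exp_add]
  rw [hc]
  push_cast
  ring_nf

theorem continuous_barnesDensity (s μ a b c : ℂ) :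
    Continuous fun x : ℝ × ℝ => barnesDensity s μ a b c x.1 x.2 := by
  have hsp := continuous_softplus
  unfold barnesDensity
  fun_prop

theorem integrable_barnesDensity_and_integral {s μ a b c : ℂ} (hs : 0 < s.re) (hμ : μ.re = 0)
    (ha : a.re = 0) (hb : b.re = 0) (hc : c.re = 0) (h : a + b + c = 0) :
    Integrable (fun x : ℝ × ℝ => barnesDensity s μ a b c x.1 x.2) (volume.prod volume) ∧
      ∫ x : ℝ × ℝ, barnesDensity s μ a b c x.1 x.2 ∂(volume.prod volume) =
        (GammaR (s + μ - b) * GammaR (s - μ - c) / GammaR (2 * s + a)) *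
          (GammaR (s - μ - a) * GammaR (s + μ - c) / GammaR (2 * s + b)) := by
  have hsp := continuous_softplus
  have hB1 := integrable_betaDensity_and_integral (a := s + μ - b) (b := s - μ - c)
    (by simpa [hμ, hb] using hs) (by simpa [hμ, hc] using hs)
  have hB2 := integrable_betaDensity_and_integral (a := s - μ - a) (b := s + μ - c)
    (by simpa [hμ, ha] using hs) (by simpa [hμ, hc] using hs)
  rw [show s + μ - b + (s - μ - c) = 2 * s + a by linear_combination -h] at hB1
  rw [show s - μ - a + (s + μ - c) = 2 * s + b by linear_combination -h] at hB2
  set Φ : ℝ × ℝ → ℝ × ℝ := fun x =>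
    (x.1 + softplus (x.2 + softplus x.1 - x.1), x.2 + softplus x.1 - x.1) with hΦ
  have hΦm : MeasurePreserving Φ (volume.prod volume) (volume.prod volume) := by
    have h1 := measurePreserving_shear (g := fun q => softplus q - q) (by fun_prop)
    have h2 := measurePreserving_shear hsp
    have h3 := Measure.measurePreserving_swap (μ := (volume : Measure ℝ))
      (ν := (volume : Measure ℝ))
    have := h3.comp (h2.comp (h3.comp h1))
    convert! this using 1
    ext x <;> simp [hΦ, add_sub_assoc]
  have hcomp : (fun x : ℝ × ℝ => barnesDensity s μ a b c x.1 x.2) ∘ Φ = fun x : ℝ × ℝ =>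
      betaDensity (s + μ - b) (s - μ - c) x.1 * betaDensity (s - μ - a) (s + μ - c) x.2 := by
    ext x
    exact barnesDensity_eq h x.1 x.2
  have hcont := continuous_barnesDensity s μ a b c
  refine ⟨(hΦm.integrable_comp hcont.aestronglyMeasurable).1
    (hcomp ▸ hB1.1.mul_prod hB2.1), ?_⟩
  rw [← hB1.2, ← hB2.2, ← integral_prod_mul, ← hcomp]
  conv_lhs => rw [← hΦm.map_eq, integral_map hΦm.aemeasurable hcont.aestronglyMeasurable]
  rfl

theorem integrable_barnes_kernel {s μ a b : ℂ} {l : ℝ} (hl : 0 ≤ l) (hs : 0 < s.re)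
    (hμ : μ.re = 0) (ha : a.re = 0) (hb : b.re = 0) :
    Integrable fun w : ℝ => Complex.exp (-a * w - (s + μ + -a) / 2 * softplus (2 * w)) *
      Complex.exp (-b * (l - w : ℝ) - (s - μ + -b) / 2 * softplus (2 * (l - w))) := by
  have hsp := continuous_softplus
  have hi : Integrable fun w : ℝ => betaDensity s s (2 * w) :=
    (integrable_comp_mul_left_iff _ two_ne_zero).2 (integrable_betaDensity_and_integral hs hs).1
  refine hi.mono (Continuous.aestronglyMeasurable (by fun_prop)) (ae_of_all _ fun w => ?_)
  have h1 : softplus (2 * w) - 2 * w ≤ softplus (2 * (l - w)) := by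
    rw [← softplus_neg]
    exact softplus_mono (by linarith)
  rw [betaDensity, ← Complex.exp_add, Complex.norm_exp, Complex.norm_exp]
  refine Real.exp_le_exp.2 ?_
  simp [ha, hb, hμ]
  nlinarith

theorem integrable_besselKernel_mul {s μ a b : ℂ} (hs : 0 < s.re)
    (hμ : μ.re = 0) (ha : a.re = 0) (hb : b.re = 0) (τ : ℝ) :
    Integrable fun η => besselKernel (s + μ) (s - μ) η *
      besselKernel (-a) (-b) (η + softplus τ / 2) :=
  (integrable_besselKernel_mul_and_integral (by simpa [hμ, ha] using hs)
    (by simpa [hμ, hb] using hs)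
    (integrable_barnes_kernel (by linarith [softplus_nonneg τ]) hs hμ ha hb)).1

theorem exp_mul_integral_besselKernel_mul {s μ a b c : ℂ} (hs : 0 < s.re)
    (hμ : μ.re = 0) (ha : a.re = 0) (hb : b.re = 0) (τ : ℝ) :
    Complex.exp ((s + c / 2) * τ - s * softplus τ) *
      ∫ η, besselKernel (s + μ) (s - μ) η * besselKernel (-a) (-b) (η + softplus τ / 2) =
    2 * GammaR (s + μ - a) * GammaR (s - μ - b) * ∫ p, barnesDensity s μ a b c τ p := by
  rw [(integrable_besselKernel_mul_and_integral (by simpa [hμ, ha] using hs)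
    (by simpa [hμ, hb] using hs)
    (integrable_barnes_kernel (by linarith [softplus_nonneg τ]) hs hμ ha hb)).2]
  have h := Measure.integral_comp_mul_left (fun p => barnesDensity s μ a b c τ p) 2
  rw [show ∫ p, barnesDensity s μ a b c τ p = 2 * ∫ w, barnesDensity s μ a b c τ (2 * w) by
    rw [h]; simp]
  simp only [barnesDensity]
  rw [integral_const_mul]
  have e : ∀ w : ℝ, softplus (2 * (softplus τ / 2 - w)) = softplus (softplus τ - 2 * w) :=
    fun w => by ring_nf
  simp_rw [e, ← sub_eq_add_neg]
  push_cast
  have e2 : ∀ w : ℝ, (softplus τ - 2 * w : ℂ) / 2 = softplus τ / 2 - w := fun w => by ring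
  have e3 : ∀ w : ℝ, (2 * w : ℂ) / 2 = w := fun w => by ring
  simp_rw [e2, e3]
  ring

/-- A real-variable form of the second Barnes lemma. -/
theorem integrable_exp_mul_integral_besselKernel_and_integral {s μ a b c : ℂ} (hs : 0 < s.re)
    (hμ : μ.re = 0) (ha : a.re = 0) (hb : b.re = 0) (hc : c.re = 0) (h : a + b + c = 0) :
    Integrable (fun τ : ℝ => Complex.exp ((s + c / 2) * τ - s * softplus τ) *
      ∫ η, besselKernel (s + μ) (s - μ) η * besselKernel (-a) (-b) (η + softplus τ / 2)) ∧
    ∫ τ : ℝ, Complex.exp ((s + c / 2) * τ - s * softplus τ) *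
      ∫ η, besselKernel (s + μ) (s - μ) η * besselKernel (-a) (-b) (η + softplus τ / 2) =
    2 * GammaR (s + μ - a) * GammaR (s - μ - b) *
      ((GammaR (s + μ - b) * GammaR (s - μ - c) / GammaR (2 * s + a)) *
        (GammaR (s - μ - a) * GammaR (s + μ - c) / GammaR (2 * s + b))) := by
  obtain ⟨hi, hint⟩ := integrable_barnesDensity_and_integral hs hμ ha hb hc h
  simp_rw [exp_mul_integral_besselKernel_mul hs hμ ha hb]
  refine ⟨hi.integral_prod_left.const_mul _, ?_⟩
  rw [integral_const_mul, ← hint, integral_prod _ hi]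

theorem integral_norm_besselKernel_mul_le {s μ a b : ℂ} (hs : 0 < s.re) (hμ : μ.re = 0)
    (ha : a.re = 0) (hb : b.re = 0) (τ : ℝ) :
    ∫ η, ‖besselKernel (s + μ) (s - μ) η * besselKernel (-a) (-b) (η + softplus τ / 2)‖ ≤
      ‖∫ η, besselKernel (s.re + 0) (s.re - 0) η *
        besselKernel (-0) (-0) (η + softplus τ / 2)‖ := by
  have h := integrable_besselKernel_mul (s := s.re) (μ := 0) (a := 0) (b := 0)
    (by simpa using hs) rfl rfl rfl τ
  have e₁ (η : ℝ) : ((‖besselKernel (s.re + 0) (s.re - 0) η‖ : ℝ) : ℂ) =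
      besselKernel (s.re + 0) (s.re - 0) η := by
    simpa using norm_besselKernel_re s s η
  have e₂ (η : ℝ) : ((‖besselKernel (-0) (-0) η‖ : ℝ) : ℂ) = besselKernel (-0) (-0) η := by
    simpa using norm_besselKernel_re 0 0 η
  have e : ∫ η, besselKernel (s.re + 0) (s.re - 0) η *
        besselKernel (-0) (-0) (η + softplus τ / 2) =
      ((∫ η, ‖besselKernel (s.re + 0) (s.re - 0) η *
        besselKernel (-0) (-0) (η + softplus τ / 2)‖ : ℝ) : ℂ) := by
    rw [← integral_complex_ofReal]
    congr 1 with η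
    rw [norm_mul, ofReal_mul, e₁, e₂]
  rw [e, norm_real]
  refine (integral_mono (integrable_besselKernel_mul hs hμ ha hb τ).norm h.norm fun η => ?_).trans
    (le_abs_self _)
  simp only [norm_mul]
  refine mul_le_mul ?_ ?_ (norm_nonneg _) (norm_nonneg _)
  · simpa [hμ] using norm_besselKernel_le (s + μ) (s - μ) η
  · simpa [ha, hb] using norm_besselKernel_le (-a) (-b) (η + softplus τ / 2)

/-- The joint integrand of the diagonal integral, in logarithmic coordinates. -/
noncomputable def diagonalDensity (φ : ℝ → ℂ) (s a b c : ℂ) (q : (ℝ × ℝ) × ℝ × ℝ) : ℂ :=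
  φ q.2.1 * Complex.exp ((s + c / 2) * q.2.2 - s * softplus q.2.2) *
    (besselKernel (2 * s + a) (2 * s + b) (q.1.1 + (softplus q.2.2 - q.2.2) / 2) *
      (besselKernel (s + q.2.1 * I) (s - q.2.1 * I) q.1.2 *
        besselKernel (-a) (-b) (q.1.2 + softplus q.2.2 / 2)))

theorem aestronglyMeasurable_diagonalDensity {φ : ℝ → ℂ} (hφ : Integrable φ) (s a b c : ℂ) :
    AEStronglyMeasurable (diagonalDensity φ s a b c)
      ((volume : Measure (ℝ × ℝ)).prod (volume : Measure (ℝ × ℝ))) := by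
  have hsp := continuous_softplus
  have hφ' : AEStronglyMeasurable (fun q : (ℝ × ℝ) × ℝ × ℝ => φ q.2.1)
      ((volume : Measure (ℝ × ℝ)).prod (volume : Measure (ℝ × ℝ))) :=
    (hφ.aestronglyMeasurable.comp_fst (ν := (volume : Measure ℝ))).comp_snd
  have hK {f g : (ℝ × ℝ) × ℝ × ℝ → ℂ} {l : (ℝ × ℝ) × ℝ × ℝ → ℝ} (hf : Continuous f)
      (hg : Continuous g) (hl : Continuous l) :
      AEStronglyMeasurable (fun q => besselKernel (f q) (g q) (l q))
        ((volume : Measure (ℝ × ℝ)).prod (volume : Measure (ℝ × ℝ))) :=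
    (stronglyMeasurable_besselKernel.comp_measurable
      ((hf.prodMk hg).prodMk hl).measurable).aestronglyMeasurable
  refine (hφ'.mul (Continuous.aestronglyMeasurable (by fun_prop))).mul
    ((hK ?_ ?_ ?_).mul ((hK ?_ ?_ ?_).mul (hK ?_ ?_ ?_))) <;> fun_prop

theorem integrable_diagonalDensity {φ : ℝ → ℂ} (hφ : Integrable φ) {s a b c : ℂ}
    (hs : 0 < s.re) (ha : a.re = 0) (hb : b.re = 0) (hc : c.re = 0) :
    Integrable (diagonalDensity φ s a b c)
      ((volume : Measure (ℝ × ℝ)).prod (volume : Measure (ℝ × ℝ))) := by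
  have hK : Integrable (besselKernel (2 * s + a) (2 * s + b)) :=
    integrable_besselKernel (by simpa [ha] using hs) (by simpa [hb] using hs)
  have hm := aestronglyMeasurable_diagonalDensity hφ s a b c
  refine (integrable_prod_iff' hm).2 ⟨ae_of_all _ fun z => ?_, ?_⟩
  · exact ((hK.comp_add_right ((softplus z.2 - z.2) / 2)).mul_prod
      (integrable_besselKernel_mul (μ := z.1 * I) hs (by simp) ha hb z.2)).const_mul
        (φ z.1 * Complex.exp ((s + c / 2) * z.2 - s * softplus z.2))
  · have hB := (integrable_exp_mul_integral_besselKernel_and_integral (s := s.re) (μ := 0)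
      (a := 0) (b := 0) (c := 0) (by simpa using hs) rfl rfl rfl rfl (by simp)).1
    refine ((hφ.norm.mul_prod hB.norm).mul_const
      (∫ η, ‖besselKernel (2 * s + a) (2 * s + b) η‖)).mono'
      hm.norm.prod_swap.integral_prod_right' (ae_of_all _ fun z => ?_)
    rw [Real.norm_of_nonneg (integral_nonneg fun _ => norm_nonneg _)]
    have e : ‖Complex.exp ((s + c / 2) * z.2 - s * softplus z.2)‖ =
        ‖Complex.exp (((s.re : ℂ) + 0 / 2) * z.2 - s.re * softplus z.2)‖ := by
      simp [Complex.norm_exp, hc]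
    simp only [diagonalDensity, norm_mul (φ _ * Complex.exp _),
      norm_mul (besselKernel (2 * s + a) _ _)]
    rw [integral_const_mul, Measure.volume_eq_prod,
      integral_prod_mul (fun x => ‖besselKernel (2 * s + a) (2 * s + b)
          (x + (softplus z.2 - z.2) / 2)‖)
        (fun x => ‖besselKernel (s + z.1 * I) (s - z.1 * I) x *
          besselKernel (-a) (-b) (x + softplus z.2 / 2)‖),
      integral_add_right_eq_self (fun x => ‖besselKernel (2 * s + a) (2 * s + b) x‖), norm_mul, e,
      norm_mul]
    have h := integral_norm_besselKernel_mul_le (μ := z.1 * I) hs (by simp) ha hb z.2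
    calc _ ≤ _ := mul_le_mul_of_nonneg_left (mul_le_mul_of_nonneg_left h
            (integral_nonneg fun _ => norm_nonneg _)) (by positivity)
      _ = _ := by ring

theorem integral_diagonalDensity {φ : ℝ → ℂ} (hφ : Integrable φ) {s a b c : ℂ}
    (hs : 0 < s.re) (ha : a.re = 0) (hb : b.re = 0) (hc : c.re = 0) (h : a + b + c = 0) :
    ∫ η₀ : ℝ, ∫ η₁ : ℝ, (∫ t : ℝ, φ t * besselKernel (s + t * I) (s - t * I) η₁) *
      (∫ τ : ℝ, Complex.exp ((s + c / 2) * τ - s * softplus τ) *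
        (besselKernel (2 * s + a) (2 * s + b) (η₀ + (softplus τ - τ) / 2) *
          besselKernel (-a) (-b) (η₁ + softplus τ / 2))) =
    2 * ∫ t : ℝ, φ t * ((GammaR (s + t * I - a) * GammaR (s - t * I - a)) *
      (GammaR (s + t * I - b) * GammaR (s - t * I - b)) *
        (GammaR (s + t * I - c) * GammaR (s - t * I - c))) := by
  have hi := integrable_diagonalDensity hφ hs ha hb hc
  have hga : 0 < (2 * s + a).re := by simpa [ha] using hs
  have hgb : 0 < (2 * s + b).re := by simpa [hb] using hs
  have inner (z : ℝ × ℝ) : ∫ w, diagonalDensity φ s a b c (w, z) =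
      φ z.1 * (GammaR (2 * s + a) * GammaR (2 * s + b) *
        (Complex.exp ((s + c / 2) * z.2 - s * softplus z.2) *
          ∫ η, besselKernel (s + z.1 * I) (s - z.1 * I) η *
            besselKernel (-a) (-b) (η + softplus z.2 / 2))) := by
    simp only [diagonalDensity]
    rw [integral_const_mul, Measure.volume_eq_prod,
      integral_prod_mul (fun x => besselKernel (2 * s + a) (2 * s + b)
          (x + (softplus z.2 - z.2) / 2))
        (fun x => besselKernel (s + z.1 * I) (s - z.1 * I) x *
          besselKernel (-a) (-b) (x + softplus z.2 / 2)),
      integral_add_right_eq_self (fun x => besselKernel (2 * s + a) (2 * s + b) x),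
      integral_besselKernel hga hgb]
    ring
  calc _ = ∫ w : ℝ × ℝ, ∫ z : ℝ × ℝ, diagonalDensity φ s a b c (w, z) := by
        refine Eq.trans ?_ (integral_prod _ hi.integral_prod_left).symm
        congr 1 with η₀
        congr 1 with η₁
        rw [← integral_prod_mul]
        congr 1 with z
        simp only [diagonalDensity]
        ring
    _ = ∫ z : ℝ × ℝ, ∫ w : ℝ × ℝ, diagonalDensity φ s a b c (w, z) :=
        integral_integral_swap hi
    _ = ∫ t : ℝ, ∫ τ : ℝ, ∫ w : ℝ × ℝ, diagonalDensity φ s a b c (w, (t, τ)) :=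
        integral_prod _ hi.integral_prod_right
    _ = _ := by
        simp_rw [inner]
        rw [← integral_const_mul]
        congr 1 with t
        rw [integral_const_mul, integral_const_mul,
          (integrable_exp_mul_integral_besselKernel_and_integral (μ := t * I) hs (by simp)
            ha hb hc h).2]
        field_simp [GammaR_ne_zero_s10 hga, GammaR_ne_zero_s10 hgb]

theorem inv_Gamma_mul_Gamma_neg (z : ℂ) :
    (Complex.Gamma z * Complex.Gamma (-z))⁻¹ = -(z * Complex.sin (Real.pi * z) / Real.pi) := by
  rcases eq_or_ne z 0 with rfl | hz
  · simp
  have h := Complex.Gamma_mul_Gamma_one_sub z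
  rw [show 1 - z = -z + 1 by ring, Complex.Gamma_add_one _ (neg_ne_zero.2 hz)] at h
  have hpi : (Real.pi : ℂ) ≠ 0 := by exact_mod_cast Real.pi_ne_zero
  rw [show Complex.Gamma z * Complex.Gamma (-z) = -(Real.pi / Complex.sin (Real.pi * z)) / z by
    rw [← h]; field_simp]
  rw [inv_div, div_neg, div_div_eq_mul_div]

theorem norm_sin_mul_I_le (x : ℝ) : ‖Complex.sin (x * I)‖ ≤ Real.exp |x| := by
  rw [Complex.sin_mul_I, norm_mul, norm_I, mul_one, ← ofReal_sinh, norm_real, Real.norm_eq_abs,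
    Real.abs_sinh, Real.sinh_eq]
  linarith [Real.exp_pos |x|, Real.exp_pos (-|x|)]

theorem MemCeta.integrable_div_Gamma {η : ℝ} (hη : 0 < η) {H : ℂ → ℂ} (hH : MemCeta η H) :
    Integrable fun t : ℝ =>
      H (t * I) / (Complex.Gamma (t * I) * Complex.Gamma (-(t * I))) := by
  obtain ⟨hd, -, C, hC⟩ := hH
  have hmem (t : ℝ) : |((t : ℂ) * I).re| < 2 * η := by simpa using hη
  have hcont : Continuous fun t : ℝ => H (t * I) :=
    hd.continuousOn.comp_continuous (by fun_prop) hmem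
  have hpi := Real.pi_pos
  have hC0 : 0 ≤ C := by simpa using (norm_nonneg _).trans (hC 0 (by simpa using hη))
  have hb (x : ℝ) (hx : 0 ≤ x) : x * Real.exp (-(Real.pi * x)) ≤ 2 * (1 + x ^ 2)⁻¹ := by
    have h₁ := Real.quadratic_le_exp_of_nonneg hx
    have h₂ : Real.exp x * Real.exp x ≤ Real.exp (Real.pi * x) := by
      rw [← Real.exp_add, Real.exp_le_exp]
      nlinarith [Real.pi_gt_three]
    rw [Real.exp_neg, ← div_eq_mul_inv, ← div_eq_mul_inv,
      div_le_div_iff₀ (Real.exp_pos _) (by positivity)]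
    calc x * (1 + x ^ 2) ≤ 2 * ((1 + x + x ^ 2 / 2) * (1 + x + x ^ 2 / 2)) := by
          nlinarith [pow_nonneg hx 2, pow_nonneg hx 3, pow_nonneg hx 4]
      _ ≤ 2 * (Real.exp x * Real.exp x) := by gcongr
      _ ≤ _ := by gcongr
  simp_rw [div_eq_mul_inv, inv_Gamma_mul_Gamma_neg]
  refine (integrable_inv_one_add_sq.const_mul (C / Real.pi * 2)).mono'
    (hcont.mul (by fun_prop)).aestronglyMeasurable (ae_of_all _ fun t => ?_)
  have h₁ : ‖H (t * I)‖ ≤ C * Real.exp (-2 * Real.pi * |t|) := by simpa using hC _ (hmem t)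
  have h₂ : ‖Complex.sin (Real.pi * (t * I))‖ ≤ Real.exp (Real.pi * |t|) := by
    simpa [abs_mul, abs_of_pos hpi, mul_assoc] using norm_sin_mul_I_le (Real.pi * t)
  rw [norm_mul, norm_neg, norm_div, norm_mul, norm_mul, norm_I, norm_real, norm_real,
    Real.norm_eq_abs, Real.norm_of_nonneg hpi.le, mul_one]
  calc _ ≤ C * Real.exp (-2 * Real.pi * |t|) * (|t| * Real.exp (Real.pi * |t|) / Real.pi) := by
        gcongr
    _ = C / Real.pi * (|t| * (Real.exp (-2 * Real.pi * |t|) * Real.exp (Real.pi * |t|))) := by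
        ring
    _ = C / Real.pi * (|t| * Real.exp (-(Real.pi * |t|))) := by rw [← Real.exp_add]; ring_nf
    _ ≤ C / Real.pi * (2 * (1 + |t| ^ 2)⁻¹) := by
        exact mul_le_mul_of_nonneg_left (hb _ (abs_nonneg t)) (by positivity)
    _ = _ := by rw [sq_abs, mul_assoc]

theorem setIntegral_Ioi_eq_integral_exp (g : ℝ → ℂ) :
    ∫ y in Ioi (0 : ℝ), g y = ∫ η : ℝ, Complex.exp η * g (Real.exp η) := by
  have h := integral_image_eq_integral_abs_deriv_smul MeasurableSet.univ
    (fun x _ => (Real.hasDerivAt_exp x).hasDerivWithinAt) Real.exp_injective.injOn g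
  rw [image_univ, Real.range_exp, Measure.restrict_univ] at h
  rw [h]
  congr 1 with η
  rw [abs_of_pos (Real.exp_pos _), Complex.real_smul, ofReal_exp]

theorem prod_GammaR_eq {α : Fin 3 → ℂ} (hsum : α 0 + α 1 + α 2 = 0) (s μ : ℂ) :
    (GammaR (s + μ - α 0) * GammaR (s - μ - α 0)) *
      (GammaR (s + μ - α 1) * GammaR (s - μ - α 1)) *
        (GammaR (s + μ - α 2) * GammaR (s - μ - α 2)) =
    (Real.pi : ℂ) ^ (-3 * s) * ∏ i, Complex.Gamma ((s + μ - α i) / 2) *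
      Complex.Gamma ((s - μ - α i) / 2) := by
  have hpi : (Real.pi : ℂ) ≠ 0 := by exact_mod_cast Real.pi_ne_zero
  rw [show -3 * s = (-(s + μ - α 0) / 2 + -(s - μ - α 0) / 2) +
      (-(s + μ - α 1) / 2 + -(s - μ - α 1) / 2) + (-(s + μ - α 2) / 2 + -(s - μ - α 2) / 2) by
    linear_combination -hsum]
  simp only [Complex.cpow_add _ _ hpi, Fin.prod_univ_three, GammaR]
  ring

theorem Hflat_exp (H : ℂ → ℂ) (s : ℂ) (η : ℝ) :
    Hflat H (Real.exp η) = Complex.exp ((1 / 2 - s) * η) / (8 * Real.pi) * ∫ t : ℝ,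
      H (t * I) / (Complex.Gamma (t * I) * Complex.Gamma (-(t * I))) *
        besselKernel (s + t * I) (s - t * I) η := by
  rw [Hflat, ← integral_const_mul, ← integral_const_mul]
  congr 1 with t
  rw [W2_eq_besselKernel, show s + t * I = t * I + s by ring,
    show s - t * I = -(t * I) + s by ring, besselKernel_add,
    show (η / 2 : ℂ) = (1 / 2 - s) * η + s * η by ring, Complex.exp_add]
  ring

theorem W3_exp {α : Fin 3 → ℂ} (hre : ∀ i, (α i).re = 0) (s : ℂ) (η₀ η₁ : ℝ) :
    W3 α (Real.exp η₀) (Real.exp η₁) = Complex.exp ((1 - 2 * s) * η₀ + η₁) / 4 * ∫ τ : ℝ,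
      Complex.exp ((s + α 2 / 2) * τ - s * softplus τ) *
        (besselKernel (2 * s + α 0) (2 * s + α 1) (η₀ + (softplus τ - τ) / 2) *
          besselKernel (-α 0) (-α 1) (η₁ + softplus τ / 2)) := by
  rw [W3_eq_integral hre, ← integral_const_mul, ← integral_const_mul]
  congr 1 with τ
  rw [show 2 * s + α 0 = (1 + α 0) + (2 * s - 1) by ring,
    show 2 * s + α 1 = (1 + α 1) + (2 * s - 1) by ring, besselKernel_add,
    show 1 - α 0 = -α 0 + 1 by ring, show 1 - α 1 = -α 1 + 1 by ring, besselKernel_add,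
    betaDensity]
  have e : Complex.exp ((1 + α 2) / 2 * τ - (1 + α 2 + (1 - α 2)) / 2 * softplus τ) *
      Complex.exp (1 * (η₁ + softplus τ / 2 : ℝ)) =
    Complex.exp ((1 - 2 * s) * η₀ + η₁) * Complex.exp ((s + α 2 / 2) * τ - s * softplus τ) *
      Complex.exp ((2 * s - 1) * (η₀ + (softplus τ - τ) / 2 : ℝ)) := by
    simp only [← Complex.exp_add]
    push_cast
    ring_nf
  linear_combination 1 / 4 * besselKernel (1 + α 0) (1 + α 1) (η₀ + (softplus τ - τ) / 2) *
    besselKernel (-α 0) (-α 1) (η₁ + softplus τ / 2) * e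

/-- Diagonal evaluation (Proposition 7.2 of the paper). -/
theorem diagonal_evaluation (η : ℝ) (hη : 40 < η) (H : ℂ → ℂ) (hH : MemCeta η H)
    (α : Fin 3 → ℂ) (hre : ∀ i, (α i).re = 0) (hsum : α 0 + α 1 + α 2 = 0)
    (s : ℂ) (hs₁ : 7/10 < s.re) (hs₂ : s.re < 4) :
    ∫ y0 in Ioi (0:ℝ), ∫ y1 in Ioi (0:ℝ),
        Hflat H y1 * ((y0 ^ 2 * y1 : ℝ) : ℂ) ^ (s - 1/2) * W3 α y0 y1 /
          ((y0 * y1 ^ 2 : ℝ) : ℂ) =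
      ((Real.pi : ℂ) ^ (-3 * s) / 8) * ((1 / (2 * (Real.pi : ℂ))) *
        ∫ t : ℝ, (H (t * I) / (Complex.Gamma (t * I) * Complex.Gamma (-(t * I)))) *
          ∏ i, Complex.Gamma ((s + t * I - α i) / 2) *
            Complex.Gamma ((s - t * I - α i) / 2)) := by
  have hs : 0 < s.re := by linarith
  have hφ := hH.integrable_div_Gamma (by linarith)
  have hpi : (Real.pi : ℂ) ≠ 0 := by exact_mod_cast Real.pi_ne_zero
  calc _ = ∫ η₀ : ℝ, ∫ η₁ : ℝ, 1 / (32 * Real.pi : ℂ) * ((∫ t : ℝ,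
        H (t * I) / (Complex.Gamma (t * I) * Complex.Gamma (-(t * I))) *
          besselKernel (s + t * I) (s - t * I) η₁) *
      (∫ τ : ℝ, Complex.exp ((s + α 2 / 2) * τ - s * softplus τ) *
        (besselKernel (2 * s + α 0) (2 * s + α 1) (η₀ + (softplus τ - τ) / 2) *
          besselKernel (-α 0) (-α 1) (η₁ + softplus τ / 2)))) := by
        rw [setIntegral_Ioi_eq_integral_exp]
        congr 1 with η₀
        rw [setIntegral_Ioi_eq_integral_exp, ← integral_const_mul]
        congr 1 with η₁
        have e₁ : Real.exp η₀ ^ 2 * Real.exp η₁ = Real.exp (2 * η₀ + η₁) := by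
          rw [← Real.exp_nat_mul, ← Real.exp_add]
          norm_num
        have e₂ : Real.exp η₀ * Real.exp η₁ ^ 2 = Real.exp (η₀ + 2 * η₁) := by
          rw [← Real.exp_nat_mul, ← Real.exp_add]
          norm_num
        rw [e₁, e₂, ofReal_exp_cpow, Hflat_exp H s, W3_exp hre s, ofReal_exp]
        have e₃ : Complex.exp η₀ * Complex.exp η₁ * (Complex.exp ((1 / 2 - s) * η₁) *
            Complex.exp ((2 * η₀ + η₁ : ℝ) * (s - 1 / 2)) *
            Complex.exp ((1 - 2 * s) * η₀ + η₁)) = Complex.exp (η₀ + 2 * η₁ : ℝ) := by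
          simp only [← Complex.exp_add]
          push_cast
          ring_nf
        have key (X Y : ℂ) : Complex.exp η₀ * (Complex.exp η₁ *
            (Complex.exp ((1 / 2 - s) * η₁) / (8 * Real.pi) * X *
              Complex.exp ((2 * η₀ + η₁ : ℝ) * (s - 1 / 2)) *
              (Complex.exp ((1 - 2 * s) * η₀ + η₁) / 4 * Y) /
                Complex.exp (η₀ + 2 * η₁ : ℝ))) = 1 / (32 * Real.pi) * (X * Y) := by
          rw [← e₃]
          field_simp
          ring
        exact key _ _
    _ = _ := by
        simp_rw [integral_const_mul]
        rw [integral_diagonalDensity hφ hs (hre 0) (hre 1) (hre 2) hsum]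
        simp_rw [prod_GammaR_eq hsum, mul_left_comm _ ((Real.pi : ℂ) ^ (-3 * s))]
        rw [integral_const_mul]
        have key (P J : ℂ) : 1 / (32 * Real.pi) * (2 * (P * J)) =
            P / 8 * (1 / (2 * Real.pi) * J) := by
          field_simp
          ring
        exact key _ _
end
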